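/- arXiv:1606.07474 — 2 statements merged into one kernel-verified Lean document; each statement's English description precedes it below -/
import Mathlib

section
/- Let a = (a₁, …, a_n) ∈ ℝⁿ and let ξ ∈ {-1,1}ⁿ be uniform. Then |E[|∑_i a_i ξ_i|] − √(2/π)·‖a‖₂| ≤ (1 − √(2/π))·‖a‖_∞. -/
/-- The `±1` vector associated to `ε : Fin n → Bool`. -/
def Xpm {n : ℕ} (ε : Fin n → Bool) : Fin n → ℝ :=
  fun i => if ε i then 1 else -1

open MeasureTheory Set Filter Topology

section Signs

/-- Summing over the first sign separately. -/
lemma sum_signs_succ {n : ℕ} (a : Fin (n + 1) → ℝ) (F : ℝ → ℝ) :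
    ∑ ε : Fin (n + 1) → Bool, F (∑ i, a i * Xpm ε i) =
      ∑ ε : Fin n → Bool, (F (a 0 + ∑ i, a i.succ * Xpm ε i) +
        F (-a 0 + ∑ i, a i.succ * Xpm ε i)) := by
  rw [← (Fin.consEquiv (fun _ => Bool)).sum_comp, Fintype.sum_prod_type]
  simp [Fin.consEquiv, Fin.sum_univ_succ, Xpm, Finset.sum_add_distrib]

lemma sum_signs_cos {n : ℕ} (a : Fin n → ℝ) (x : ℝ) :
    ∑ ε : Fin n → Bool, Real.cos (x + ∑ i, a i * Xpm ε i) =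
      2 ^ n * (Real.cos x * ∏ i, Real.cos (a i)) := by
  induction n generalizing x with
  | zero => simp
  | succ n ih =>
    rw [sum_signs_succ a (fun y => Real.cos (x + y)), Finset.sum_add_distrib]
    simp only [← add_assoc]
    rw [ih (fun i => a i.succ), ih (fun i => a i.succ), Fin.prod_univ_succ, Real.cos_add,
      Real.cos_add, Real.cos_neg, Real.sin_neg]
    ring

lemma sum_signs_sq {n : ℕ} (a : Fin n → ℝ) (x : ℝ) :
    ∑ ε : Fin n → Bool, (x + ∑ i, a i * Xpm ε i) ^ 2 = 2 ^ n * (x ^ 2 + ∑ i, a i ^ 2) := by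
  induction n generalizing x with
  | zero => simp
  | succ n ih =>
    rw [sum_signs_succ a (fun y => (x + y) ^ 2), Finset.sum_add_distrib]
    simp only [← add_assoc]
    rw [ih (fun i => a i.succ), ih (fun i => a i.succ), Fin.sum_univ_succ]
    ring

lemma sum_signs_flip {n : ℕ} (a : Fin n → ℝ) (k : Fin n) (F : ℝ → ℝ) :
    ∑ ε : Fin n → Bool, F (∑ i, a i * Xpm ε i - 2 * (a k * Xpm ε k)) =
      ∑ ε : Fin n → Bool, F (∑ i, a i * Xpm ε i) := by
  have hinv : Function.Involutive
      (fun ε : Fin n → Bool => Function.update ε k (!ε k)) := by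
    intro ε
    simp
  rw [← Equiv.sum_comp hinv.toPerm]
  refine Finset.sum_congr rfl fun ε _ => ?_
  congr 1
  have h : ∀ i, a i * Xpm (Function.update ε k (!ε k)) i =
      a i * Xpm ε i - if i = k then 2 * (a k * Xpm ε k) else 0 := by
    intro i
    by_cases hi : i = k
    · subst hi
      cases h : ε i <;> simp [Xpm, h] <;> ring
    · simp [Xpm, hi]
  have h2 := h k
  simp only [if_true] at h2
  simp only [Function.Involutive.coe_toPerm, h, Finset.sum_sub_distrib, Finset.sum_ite_eq',
    Finset.mem_univ, if_true]
  ring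

lemma Xpm_sq {n : ℕ} (ε : Fin n → Bool) (k : Fin n) : Xpm ε k ^ 2 = 1 := by
  cases h : ε k <;> simp [Xpm, h]

lemma one_le_sum_signs_abs {n : ℕ} (a : Fin n → ℝ) (k : Fin n) (hk : |a k| = 1) :
    2 ^ n ≤ ∑ ε : Fin n → Bool, |∑ i, a i * Xpm ε i| := by
  have h1 := sum_signs_flip a k (fun x => |x|)
  have h2 : ∑ _ε : Fin n → Bool, (2 : ℝ) ≤ ∑ ε : Fin n → Bool,
      (|∑ i, a i * Xpm ε i| + |∑ i, a i * Xpm ε i - 2 * (a k * Xpm ε k)|) := by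
    refine Finset.sum_le_sum fun ε _ => ?_
    have h3 := abs_sub (∑ i, a i * Xpm ε i) (∑ i, a i * Xpm ε i - 2 * (a k * Xpm ε k))
    have h4 : |Xpm ε k| = 1 := by
      rw [← sq_eq_sq₀ (abs_nonneg _) zero_le_one, sq_abs, Xpm_sq, one_pow]
    rwa [sub_sub_cancel, abs_mul, abs_mul, hk, h4, abs_two, one_mul, mul_one] at h3
  rw [Finset.sum_add_distrib] at h2
  simp at h2 h1
  linarith

lemma sum_signs_abs_le {n : ℕ} (a : Fin n → ℝ) (k : Fin n) (hk : |a k| = 1) :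
    ∑ ε : Fin n → Bool, |∑ i, a i * Xpm ε i| ≤ 2 ^ n * (1 + (∑ i, a i ^ 2 - 1) / 4) := by
  have h1 := sum_signs_flip a k (fun x => |x|)
  have h1' := sum_signs_flip a k (fun x => x ^ 2)
  have hsq := sum_signs_sq a 0
  have h2 : ∑ ε : Fin n → Bool,
      (|∑ i, a i * Xpm ε i| + |∑ i, a i * Xpm ε i - 2 * (a k * Xpm ε k)|) ≤
      ∑ ε : Fin n → Bool, (((∑ i, a i * Xpm ε i) ^ 2 +
        (∑ i, a i * Xpm ε i - 2 * (a k * Xpm ε k)) ^ 2) / 4 + 3 / 2) := by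
    refine Finset.sum_le_sum fun ε _ => ?_
    have h4 : (a k * Xpm ε k) ^ 2 = 1 := by
      rw [mul_pow, Xpm_sq, ← sq_abs, hk]; norm_num
    set S := ∑ i, a i * Xpm ε i
    rcases sq_eq_one_iff.mp h4 with h | h <;> rw [h] <;>
    rcases abs_cases S with ⟨h5, h6⟩ | ⟨h5, h6⟩ <;>
    [rcases abs_cases (S - 2 * 1) with ⟨h7, h8⟩ | ⟨h7, h8⟩;
      rcases abs_cases (S - 2 * 1) with ⟨h7, h8⟩ | ⟨h7, h8⟩;
      rcases abs_cases (S - 2 * -1) with ⟨h7, h8⟩ | ⟨h7, h8⟩;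
      rcases abs_cases (S - 2 * -1) with ⟨h7, h8⟩ | ⟨h7, h8⟩] <;>
    rw [h5, h7] <;>
    nlinarith [sq_nonneg (S + 1), sq_nonneg (S - 1), sq_nonneg (S - 3), sq_nonneg (S + 3)]
  rw [Finset.sum_add_distrib, Finset.sum_add_distrib, ← Finset.sum_div,
    Finset.sum_add_distrib] at h2
  simp at h2 h1 h1' hsq
  rw [h1, h1', hsq] at h2
  linarith

end Signs
section Bounds

lemma nonneg_of_hasDerivAt_nonneg {f f' : ℝ → ℝ} (h0 : f 0 = 0)
    (hd : ∀ y, HasDerivAt f (f' y) y) (hn : ∀ y, 0 ≤ y → 0 ≤ f' y) {x : ℝ} (hx : 0 ≤ x) :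
    0 ≤ f x := by
  have h : MonotoneOn f (Ici 0) :=
    monotoneOn_of_hasDerivWithinAt_nonneg (convex_Ici 0)
      (fun y _ => (hd y).continuousAt.continuousWithinAt)
      (fun y _ => (hd y).hasDerivWithinAt) fun y hy => by
        rw [interior_Ici] at hy
        exact hn y (le_of_lt hy)
  have := h (mem_Ici.mpr le_rfl) (mem_Ici.mpr hx) hx
  rwa [h0] at this

lemma le_sin_of_nonneg {x : ℝ} (hx : 0 ≤ x) : x - x ^ 3 / 6 ≤ Real.sin x := by
  refine sub_nonneg.mp (nonneg_of_hasDerivAt_nonneg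
    (f := fun y => Real.sin y - (y - y ^ 3 / 6))
    (f' := fun y => Real.cos y - (1 - y ^ 2 / 2)) (by simp) (fun y => ?_) (fun y _ => ?_) hx)
  · exact ((Real.hasDerivAt_sin y).sub ((hasDerivAt_id y).sub
      ((hasDerivAt_pow 3 y).div_const 6))).congr_deriv (by push_cast; ring)
  · linarith [Real.one_sub_sq_div_two_le_cos (x := y)]

lemma cos_le_of_nonneg {x : ℝ} (hx : 0 ≤ x) : Real.cos x ≤ 1 - x ^ 2 / 2 + x ^ 4 / 24 := by
  refine sub_nonneg.mp (nonneg_of_hasDerivAt_nonneg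
    (f := fun y => (1 - y ^ 2 / 2 + y ^ 4 / 24) - Real.cos y)
    (f' := fun y => Real.sin y - (y - y ^ 3 / 6)) (by simp) (fun y => ?_) (fun y hy => ?_) hx)
  · exact (((((hasDerivAt_pow 2 y).div_const 2).const_sub 1).add
      ((hasDerivAt_pow 4 y).div_const 24)).sub (Real.hasDerivAt_cos y)).congr_deriv
      (by push_cast; ring)
  · linarith [le_sin_of_nonneg hy]

lemma sin_le_of_nonneg {x : ℝ} (hx : 0 ≤ x) :
    Real.sin x ≤ x - x ^ 3 / 6 + x ^ 5 / 120 := by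
  refine sub_nonneg.mp (nonneg_of_hasDerivAt_nonneg
    (f := fun y => (y - y ^ 3 / 6 + y ^ 5 / 120) - Real.sin y)
    (f' := fun y => (1 - y ^ 2 / 2 + y ^ 4 / 24) - Real.cos y)
    (by simp) (fun y => ?_) (fun y hy => ?_) hx)
  · exact ((((hasDerivAt_id y).sub ((hasDerivAt_pow 3 y).div_const 6)).add
      ((hasDerivAt_pow 5 y).div_const 120)).sub (Real.hasDerivAt_sin y)).congr_deriv
      (by push_cast; ring)
  · linarith [cos_le_of_nonneg hy]

lemma le_cos_of_nonneg {x : ℝ} (hx : 0 ≤ x) :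
    1 - x ^ 2 / 2 + x ^ 4 / 24 - x ^ 6 / 720 ≤ Real.cos x := by
  refine sub_nonneg.mp (nonneg_of_hasDerivAt_nonneg
    (f := fun y => Real.cos y - (1 - y ^ 2 / 2 + y ^ 4 / 24 - y ^ 6 / 720))
    (f' := fun y => (y - y ^ 3 / 6 + y ^ 5 / 120) - Real.sin y)
    (by simp) (fun y => ?_) (fun y hy => ?_) hx)
  · exact ((Real.hasDerivAt_cos y).sub (((((hasDerivAt_pow 2 y).div_const 2).const_sub 1).add
      ((hasDerivAt_pow 4 y).div_const 24)).sub ((hasDerivAt_pow 6 y).div_const 720))).congr_deriv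
      (by push_cast; ring)
  · linarith [sin_le_of_nonneg hy]

lemma cos_le_exp_neg_sq_div_two {x : ℝ} (hx : |x| ≤ Real.pi / 2) :
    Real.cos x ≤ Real.exp (-(x ^ 2 / 2)) := by
  rw [← Real.cos_abs, ← sq_abs]
  have hx0 := abs_nonneg x
  generalize |x| = y at hx hx0
  have h : AntitoneOn (fun y : ℝ => Real.cos y * Real.exp (y ^ 2 / 2)) (Icc 0 (Real.pi / 2)) := by
    refine antitoneOn_of_hasDerivWithinAt_nonpos (convex_Icc _ _) (by fun_prop)
      (f' := fun y => (y * Real.cos y - Real.sin y) * Real.exp (y ^ 2 / 2))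
      (fun y _ => ?_) fun y hy => ?_
    · exact ((Real.hasDerivAt_cos y).mul
        ((hasDerivAt_pow 2 y).div_const 2).exp).hasDerivWithinAt.congr_deriv
        (by push_cast; ring)
    · rw [interior_Icc] at hy
      refine mul_nonpos_of_nonpos_of_nonneg ?_ (Real.exp_pos _).le
      have hc : 0 < Real.cos y := Real.cos_pos_of_mem_Ioo ⟨by linarith [hy.1, Real.pi_pos], hy.2⟩
      have ht := Real.le_tan hy.1.le hy.2
      rw [Real.tan_eq_sin_div_cos, le_div_iff₀ hc] at ht
      linarith
  have := h ⟨le_rfl, by positivity⟩ ⟨hx0, hx⟩ hx0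
  rw [Real.exp_neg, ← one_div, le_div_iff₀ (Real.exp_pos _)]
  simpa using this

lemma exp_neg_sq_div_two_sub_cos_le {x : ℝ} (hx : |x| ≤ Real.pi / 2) :
    Real.exp (-(x ^ 2 / 2)) - Real.cos x ≤ x ^ 4 / 12 := by
  have hc := le_cos_of_nonneg (abs_nonneg x)
  rw [Real.cos_abs] at hc
  have hx2 : x ^ 2 ≤ 5 / 2 := by
    rw [← sq_abs]
    have := Real.pi_lt_d2
    nlinarith [abs_nonneg x]
  set y := x ^ 2 / 2 with hy
  have hy0 : 0 ≤ y := by positivity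
  have h2 : |x| ^ 2 = 2 * y := by rw [sq_abs, hy]; ring
  have h4 : |x| ^ 4 = 4 * y ^ 2 := by
    rw [show |x| ^ 4 = (|x| ^ 2) ^ 2 by ring, h2]; ring
  have h6 : |x| ^ 6 = 8 * y ^ 3 := by
    rw [show |x| ^ 6 = (|x| ^ 2) ^ 3 by ring, h2]; ring
  have h4' : x ^ 4 = 4 * y ^ 2 := by rw [hy]; ring
  rw [h2, h4, h6] at hc
  have he : 1 + y + y ^ 2 / 2 + y ^ 3 / 6 ≤ Real.exp y := by
    have := Real.sum_le_exp_of_nonneg hy0 4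
    simp [Finset.sum_range_succ, Nat.factorial] at this
    linarith
  have hy1 : y ≤ 5 / 4 := by linarith
  have key : Real.exp (-y) ≤ 1 - y + y ^ 2 / 2 - y ^ 3 / 90 := by
    rw [Real.exp_neg, inv_le_iff_one_le_mul₀ (Real.exp_pos y)]
    have hpos : 0 ≤ 1 - y + y ^ 2 / 2 - y ^ 3 / 90 := by nlinarith [sq_nonneg (y - 1)]
    refine le_trans ?_ (mul_le_mul_of_nonneg_left he hpos)
    have h3 : 0 ≤ y ^ 3 * (14 / 90 + 13 / 180 * y + 14 / 180 * y ^ 2 - y ^ 3 / 540) := by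
      refine mul_nonneg (by positivity) ?_
      nlinarith [pow_nonneg hy0 2]
    nlinarith
  rw [h4']
  linarith

end Bounds
section Integrals

lemma integrableOn_Ioi_of_abs_le {f : ℝ → ℝ} (hf : Measurable f) (C : ℝ)
    (h : ∀ t, 0 < t → |f t| ≤ C * (1 + t ^ 2)⁻¹) : IntegrableOn f (Ioi 0) := by
  refine Integrable.mono' ((integrable_inv_one_add_sq.const_mul C).integrableOn)
    hf.aestronglyMeasurable ?_
  exact (ae_restrict_mem measurableSet_Ioi).mono fun t ht => h t ht

lemma integrableOn_one_sub_cos_div_sq (x : ℝ) :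
    IntegrableOn (fun t => (1 - Real.cos (x * t)) / t ^ 2) (Ioi 0) := by
  refine integrableOn_Ioi_of_abs_le (by fun_prop) (2 + x ^ 2 / 2) fun t ht => ?_
  have h1 := Real.cos_le_one (x * t)
  have h2 := Real.neg_one_le_cos (x * t)
  have h3 := Real.one_sub_sq_div_two_le_cos (x := x * t)
  rw [abs_of_nonneg (div_nonneg (by linarith) (by positivity)), ← div_eq_mul_inv,
    div_le_div_iff₀ (by positivity) (by positivity)]
  have := sq_nonneg t
  nlinarith

lemma integrableOn_one_sub_exp_div_sq {b : ℝ} (hb : 0 ≤ b) :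
    IntegrableOn (fun t => (1 - Real.exp (-(b * t ^ 2))) / t ^ 2) (Ioi 0) := by
  refine integrableOn_Ioi_of_abs_le (by fun_prop) (1 + b) fun t ht => ?_
  have h1 : Real.exp (-(b * t ^ 2)) ≤ 1 := Real.exp_le_one_iff.mpr (by nlinarith [sq_nonneg t])
  have h2 := Real.exp_pos (-(b * t ^ 2))
  have h3 := Real.add_one_le_exp (-(b * t ^ 2))
  rw [abs_of_nonneg (div_nonneg (by linarith) (by positivity)), ← div_eq_mul_inv,
    div_le_div_iff₀ (by positivity) (by positivity)]
  have := sq_nonneg t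
  nlinarith

lemma integral_one_sub_exp_div_sq {b : ℝ} (hb : 0 < b) :
    ∫ t in Ioi 0, (1 - Real.exp (-(b * t ^ 2))) / t ^ 2 = Real.sqrt (Real.pi * b) := by
  have hgauss : Integrable (fun t : ℝ => Real.exp (-b * t ^ 2)) := integrable_exp_neg_mul_sq hb
  have hf_int : IntegrableOn (fun t => (1 - Real.exp (-(b * t ^ 2))) / t ^ 2 -
      2 * b * Real.exp (-b * t ^ 2)) (Ioi 0) :=
    (integrableOn_one_sub_exp_div_sq hb.le).sub (hgauss.const_mul _).integrableOn
  have hderiv : ∀ t ∈ Ioi (0 : ℝ), HasDerivAt (fun t => -((1 - Real.exp (-(b * t ^ 2))) / t))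
      ((1 - Real.exp (-(b * t ^ 2))) / t ^ 2 - 2 * b * Real.exp (-b * t ^ 2)) t := by
    intro t ht
    have ht0 : t ≠ 0 := ne_of_gt ht
    have := (((((hasDerivAt_pow 2 t).const_mul b).neg.exp).const_sub 1).div
      (hasDerivAt_id t) ht0).neg
    refine this.congr_deriv ?_
    simp only [id, neg_mul, Pi.neg_apply]
    field_simp
    push_cast
    ring
  have hbound : ∀ t : ℝ, 0 < t → |(1 - Real.exp (-(b * t ^ 2))) / t| ≤ min (b * t) (1 / t) := by
    intro t ht
    have h1 : Real.exp (-(b * t ^ 2)) ≤ 1 := Real.exp_le_one_iff.mpr (by nlinarith [sq_nonneg t])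
    have h2 := Real.exp_pos (-(b * t ^ 2))
    have h3 := Real.add_one_le_exp (-(b * t ^ 2))
    rw [abs_of_nonneg (div_nonneg (by linarith) ht.le), le_min_iff]
    constructor
    · rw [div_le_iff₀ ht]; nlinarith
    · gcongr; linarith
  have hzero : Tendsto (fun t => -((1 - Real.exp (-(b * t ^ 2))) / t)) (𝓝[>] 0) (𝓝 0) := by
    refine squeeze_zero_norm' (a := fun t => b * t) ?_ ?_
    · filter_upwards [self_mem_nhdsWithin] with t ht
      rw [norm_neg]
      exact (hbound t ht).trans (min_le_left _ _)
    · have : Tendsto (fun t : ℝ => b * t) (𝓝 0) (𝓝 (b * 0)) := (continuous_const_mul b).tendsto 0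
      rw [mul_zero] at this
      exact this.mono_left nhdsWithin_le_nhds
  have htop : Tendsto (fun t => -((1 - Real.exp (-(b * t ^ 2))) / t)) atTop (𝓝 0) := by
    refine squeeze_zero_norm' (a := fun t => 1 / t) ?_ (by simpa using tendsto_inv_atTop_zero)
    filter_upwards [eventually_gt_atTop 0] with t ht
    rw [norm_neg]
    exact (hbound t ht).trans (min_le_right _ _)
  have hcont : ContinuousWithinAt (fun t => -((1 - Real.exp (-(b * t ^ 2))) / t)) (Ici 0) 0 := by
    rw [← continuousWithinAt_Ioi_iff_Ici]
    simpa [ContinuousWithinAt] using hzero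
  have h := integral_Ioi_of_hasDerivAt_of_tendsto hcont hderiv hf_int htop
  rw [integral_sub (integrableOn_one_sub_exp_div_sq hb.le) (hgauss.const_mul _).integrableOn,
    integral_const_mul, integral_gaussian_Ioi, div_zero, neg_zero, sub_zero] at h
  have hs : Real.sqrt (Real.pi * b) = b * Real.sqrt (Real.pi / b) := by
    rw [show Real.pi * b = b ^ 2 * (Real.pi / b) by field_simp, Real.sqrt_mul (by positivity),
      Real.sqrt_sq hb.le]
  rw [hs]
  linarith

lemma integral_mul_exp_neg {t : ℝ} (ht : 0 < t) :
    IntegrableOn (fun u => u * Real.exp (-(t * u))) (Ioi 0) ∧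
      ∫ u in Ioi 0, u * Real.exp (-(t * u)) = 1 / t ^ 2 := by
  have h := Real.integral_rpow_mul_exp_neg_mul_Ioi (a := 2) (r := t) two_pos ht
  have he : ∀ u : ℝ, u ^ ((2 : ℝ) - 1) = u := fun u => by norm_num
  simp only [he] at h
  have h2 : ∫ u in Ioi 0, u * Real.exp (-(t * u)) = 1 / t ^ 2 := by
    rw [h]; simp
  exact ⟨Integrable.of_integral_ne_zero (by rw [h2]; positivity), h2⟩

lemma integral_one_sub_cos_mul_exp {u : ℝ} (hu : 0 < u) :
    ∫ t in Ioi 0, (1 - Real.cos t) * (u * Real.exp (-(t * u))) = (1 + u ^ 2)⁻¹ := by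
  have hderiv : ∀ t ∈ Ici (0 : ℝ), HasDerivAt
      (fun t => -Real.exp (-(t * u)) *
        (1 + u * (Real.sin t - u * Real.cos t) / (1 + u ^ 2)))
      ((1 - Real.cos t) * (u * Real.exp (-(t * u)))) t := by
    intro t _
    have := (((hasDerivAt_id t).mul_const u).neg.exp.neg).mul
      (((((Real.hasDerivAt_sin t).sub ((Real.hasDerivAt_cos t).const_mul u)).const_mul
        u).div_const (1 + u ^ 2)).const_add 1)
    refine this.congr_deriv ?_
    simp only [id, Pi.neg_apply, Pi.sub_apply, mul_comm u]
    field_simp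
    ring
  have hnn : ∀ t ∈ Ioi (0 : ℝ), 0 ≤ (1 - Real.cos t) * (u * Real.exp (-(t * u))) := fun t _ =>
    mul_nonneg (sub_nonneg.mpr (Real.cos_le_one t)) (by positivity)
  have hlim : Tendsto (fun t => -Real.exp (-(t * u)) *
        (1 + u * (Real.sin t - u * Real.cos t) / (1 + u ^ 2))) atTop (𝓝 0) := by
    have he : Tendsto (fun t : ℝ => -Real.exp (-(t * u))) atTop (𝓝 0) := by
      rw [← neg_zero]
      refine (Real.tendsto_exp_neg_atTop_nhds_zero.comp ?_).neg
      exact tendsto_id.atTop_mul_const hu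
    refine Tendsto.zero_mul_isBoundedUnder_le he ?_
    refine isBoundedUnder_of ⟨1 + u * (1 + u * 1) / (1 + u ^ 2), fun t => ?_⟩
    simp only [Function.comp, Real.norm_eq_abs]
    refine (abs_add_le _ _).trans ?_
    rw [abs_one, abs_div, abs_mul, abs_of_pos hu, abs_of_pos (by positivity : 0 < 1 + u ^ 2)]
    gcongr
    refine (abs_sub _ _).trans ?_
    rw [abs_mul, abs_of_pos hu]
    gcongr
    · exact Real.abs_sin_le_one t
    · exact Real.abs_cos_le_one t
  rw [integral_Ioi_of_hasDerivAt_of_nonneg' hderiv hnn hlim]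
  simp
  field_simp
  ring

lemma integral_one_sub_cos_div_sq_one :
    ∫ t in Ioi 0, (1 - Real.cos t) / t ^ 2 = Real.pi / 2 := by
  set μ := (volume : Measure ℝ).restrict (Ioi 0)
  have hinner : ∀ t ∈ Ioi (0 : ℝ),
      ∫ u in Ioi 0, (1 - Real.cos t) * (u * Real.exp (-(t * u))) = (1 - Real.cos t) / t ^ 2 := by
    intro t ht
    rw [integral_const_mul, (integral_mul_exp_neg ht).2]
    ring
  have hf_int : Integrable (Function.uncurry fun t u : ℝ =>
      (1 - Real.cos t) * (u * Real.exp (-(t * u)))) (μ.prod μ) := by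
    rw [integrable_prod_iff (by fun_prop)]
    constructor
    · exact (ae_restrict_mem measurableSet_Ioi).mono fun t ht =>
        (integral_mul_exp_neg ht).1.const_mul (1 - Real.cos t)
    · have h := integrableOn_one_sub_cos_div_sq 1
      simp only [one_mul] at h
      refine h.congr ((ae_restrict_mem measurableSet_Ioi).mono fun t ht => ?_)
      dsimp only
      rw [← hinner t ht]
      refine setIntegral_congr_fun measurableSet_Ioi fun u hu => ?_
      exact (Real.norm_of_nonneg (mul_nonneg (sub_nonneg.mpr (Real.cos_le_one t))
        (mul_nonneg (le_of_lt hu) (Real.exp_pos _).le))).symm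
  have hswap := integral_integral_swap hf_int
  rw [← setIntegral_congr_fun measurableSet_Ioi hinner, hswap,
    setIntegral_congr_fun measurableSet_Ioi fun u hu => integral_one_sub_cos_mul_exp hu,
    integral_Ioi_inv_one_add_sq]
  simp

lemma integral_one_sub_cos_div_sq (x : ℝ) :
    ∫ t in Ioi 0, (1 - Real.cos (x * t)) / t ^ 2 = Real.pi / 2 * |x| := by
  rcases eq_or_ne x 0 with rfl | hx
  · simp
  have hx' : 0 < |x| := abs_pos.mpr hx
  have h := integral_comp_mul_left_Ioi (fun t => (1 - Real.cos t) / t ^ 2) 0 hx'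
  rw [mul_zero, integral_one_sub_cos_div_sq_one, smul_eq_mul] at h
  have h2 : ∀ t : ℝ, (1 - Real.cos (x * t)) / t ^ 2 =
      |x| ^ 2 * ((1 - Real.cos (|x| * t)) / (|x| * t) ^ 2) := by
    intro t
    have : Real.cos (|x| * t) = Real.cos (x * t) := by
      rw [← Real.cos_abs, ← Real.cos_abs (x * t), abs_mul, abs_mul, abs_abs]
    rw [this, mul_pow]
    field_simp
  simp only [h2]
  rw [integral_const_mul, h]
  field_simp

end Integrals
section Tail

lemma integrableOn_Ioi_div_sq {f : ℝ → ℝ} (hf : Measurable f) {c : ℝ} (hc : 0 < c)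
    (h : ∀ t, c < t → |f t| ≤ 1) : IntegrableOn (fun t => f t / t ^ 2) (Ioi c) := by
  have h0 := integrableOn_Ioi_rpow_of_lt (a := -2) (by norm_num) hc
  refine Integrable.mono' h0 (hf.div (by fun_prop)).aestronglyMeasurable ?_
  refine (ae_restrict_mem measurableSet_Ioi).mono fun t ht => ?_
  have ht0 : 0 < t := hc.trans ht
  rw [Real.norm_eq_abs, abs_div, abs_of_pos (by positivity : 0 < t ^ 2), Real.rpow_neg ht0.le,
    Real.rpow_two, ← one_div]
  gcongr
  exact h t ht

lemma integral_Ioi_one_div_sq {c : ℝ} (hc : 0 < c) : ∫ t in Ioi c, 1 / t ^ 2 = 1 / c := by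
  have h0 := integral_Ioi_rpow_of_lt (a := -2) (by norm_num) hc
  have : ∀ t ∈ Ioi c, 1 / t ^ 2 = t ^ (-2 : ℝ) := fun t ht => by
    rw [Real.rpow_neg (hc.trans ht).le, Real.rpow_two, one_div]
  rw [setIntegral_congr_fun measurableSet_Ioi this, h0]
  norm_num [Real.rpow_neg_one]

lemma half_pi_pos : 0 < Real.pi / 2 := by positivity

lemma integrableOn_cos_pow_div_sq (p : ℕ) :
    IntegrableOn (fun t => Real.cos t ^ p / t ^ 2) (Ioi (Real.pi / 2)) :=
  integrableOn_Ioi_div_sq (by fun_prop) half_pi_pos fun t _ => by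
    rw [abs_pow]
    exact pow_le_one₀ (abs_nonneg _) (Real.abs_cos_le_one t)

lemma Ioc_union_Ioi_half_pi : Ioc 0 (Real.pi / 2) ∪ Ioi (Real.pi / 2) = Ioi (0 : ℝ) :=
  Ioc_union_Ioi_eq_Ioi half_pi_pos.le

lemma integral_Ioi_eq_add {f : ℝ → ℝ} (hf : IntegrableOn f (Ioi 0)) :
    ∫ t in Ioi 0, f t = (∫ t in Ioc 0 (Real.pi / 2), f t) + ∫ t in Ioi (Real.pi / 2), f t := by
  rw [← Ioc_union_Ioi_half_pi] at hf ⊢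
  exact setIntegral_union (Set.Ioc_disjoint_Ioi le_rfl) measurableSet_Ioi
    hf.left_of_union hf.right_of_union

lemma integral_cos_sq_div_sq_le :
    ∫ t in Ioi (Real.pi / 2), Real.cos t ^ 2 / t ^ 2 ≤
      2 / Real.pi - (Real.pi / 2) ^ 3 / 9 + 2 * (Real.pi / 2) ^ 5 / 225 := by
  have hsq : ∀ t : ℝ, (1 - Real.cos (2 * t)) / t ^ 2 / 2 = Real.sin t ^ 2 / t ^ 2 := fun t => by
    rw [Real.cos_two_mul, Real.cos_sq']
    ring
  have hf_int : IntegrableOn (fun t => Real.sin t ^ 2 / t ^ 2) (Ioi 0) := by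
    have h := (integrableOn_one_sub_cos_div_sq 2).div_const 2
    simp only [hsq] at h
    exact h
  have htot : ∫ t in Ioi 0, Real.sin t ^ 2 / t ^ 2 = Real.pi / 2 := by
    simp only [← hsq]
    rw [integral_div, integral_one_sub_cos_div_sq]
    norm_num
  rw [integral_Ioi_eq_add hf_int] at htot
  have hhead : ∫ t in Ioc 0 (Real.pi / 2), Real.sin t ^ 2 / t ^ 2 ≤
      ∫ t in Ioc 0 (Real.pi / 2), (1 - t ^ 2 / 3 + 2 * t ^ 4 / 45) := by
    refine setIntegral_mono_on (hf_int.mono_set Ioc_subset_Ioi_self)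
      (Continuous.integrableOn_Ioc (by fun_prop)) measurableSet_Ioc fun t ht => ?_
    rw [← hsq, div_div, div_le_iff₀ (by have := ht.1; positivity)]
    have := le_cos_of_nonneg (x := 2 * t) (by linarith [ht.1])
    nlinarith
  have hpoly : ∫ t in Ioc 0 (Real.pi / 2), (1 - t ^ 2 / 3 + 2 * t ^ 4 / 45) =
      Real.pi / 2 - (Real.pi / 2) ^ 3 / 9 + 2 * (Real.pi / 2) ^ 5 / 225 := by
    rw [← intervalIntegral.integral_of_le half_pi_pos.le,
      intervalIntegral.integral_eq_sub_of_hasDerivAt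
        (f := fun t => t - t ^ 3 / 9 + 2 * t ^ 5 / 225) (fun t _ => ?_)
        (Continuous.intervalIntegrable (by fun_prop) _ _)]
    · simp
    · exact (((hasDerivAt_id t).sub ((hasDerivAt_pow 3 t).div_const 9)).add
        (((hasDerivAt_pow 5 t).const_mul 2).div_const 225)).congr_deriv (by push_cast; ring)
  have hcos : ∫ t in Ioi (Real.pi / 2), Real.cos t ^ 2 / t ^ 2 =
      2 / Real.pi - ∫ t in Ioi (Real.pi / 2), Real.sin t ^ 2 / t ^ 2 := by
    have h1 := integral_Ioi_one_div_sq half_pi_pos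
    rw [one_div_div] at h1
    rw [← h1, ← integral_sub (integrableOn_Ioi_div_sq (by fun_prop) half_pi_pos (by simp))
      (hf_int.mono_set (Ioi_subset_Ioi half_pi_pos.le))]
    refine integral_congr_ae (ae_of_all _ fun t => ?_)
    simp only [Real.cos_sq']
    ring
  rw [hcos]
  linarith

lemma le_integral_sin_two_mul_sq_div_sq :
    1 / (4 * Real.pi) - 1 / (8 * Real.pi ^ 2) ≤
      ∫ t in Ioi (Real.pi / 2), Real.sin (2 * t) ^ 2 / 4 / t ^ 2 := by
  have hderiv : ∀ t ∈ Ici (Real.pi / 2), HasDerivAt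
      (fun t => (1 - Real.sin (4 * t)) / (32 * t ^ 2) - 1 / (8 * t))
      ((1 / 8 - Real.cos (4 * t) / 8 - (1 - Real.sin (4 * t)) / (16 * t)) / t ^ 2) t := by
    intro t ht
    have ht0 : t ≠ 0 := (half_pi_pos.trans_le ht).ne'
    have := ((((hasDerivAt_id t).const_mul 4).sin.const_sub 1).div
      ((hasDerivAt_pow 2 t).const_mul 32) (by positivity)).sub
      ((hasDerivAt_const t (1 : ℝ)).div ((hasDerivAt_id t).const_mul 8)
        (mul_ne_zero (by norm_num) ht0))
    refine this.congr_deriv ?_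
    simp only [id]
    field_simp
    push_cast
    ring
  have hf_int : IntegrableOn (fun t =>
      (1 / 8 - Real.cos (4 * t) / 8 - (1 - Real.sin (4 * t)) / (16 * t)) / t ^ 2)
      (Ioi (Real.pi / 2)) := by
    refine integrableOn_Ioi_div_sq (by fun_prop) half_pi_pos fun t ht => ?_
    have ht1 : 1 < t := by linarith [Real.pi_gt_three]
    have h1 := Real.cos_le_one (4 * t)
    have h2 := Real.neg_one_le_cos (4 * t)
    have h3 := Real.sin_le_one (4 * t)
    have h4 := Real.neg_one_le_sin (4 * t)
    have h5 : 0 ≤ (1 - Real.sin (4 * t)) / (16 * t) := div_nonneg (by linarith) (by linarith)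
    have h6 : (1 - Real.sin (4 * t)) / (16 * t) ≤ 1 / 8 := by
      rw [div_le_iff₀ (by linarith)]
      linarith
    rw [abs_le]
    constructor <;> linarith
  have hlim : Tendsto (fun t : ℝ => (1 - Real.sin (4 * t)) / (32 * t ^ 2) - 1 / (8 * t)) atTop
      (𝓝 0) := by
    refine squeeze_zero_norm' (a := fun t => 1 / t) ?_ (by simpa using tendsto_inv_atTop_zero)
    filter_upwards [eventually_gt_atTop 1] with t ht
    have h3 := Real.sin_le_one (4 * t)
    have h4 := Real.neg_one_le_sin (4 * t)
    have h5 : 0 ≤ (1 - Real.sin (4 * t)) / (32 * t ^ 2) := div_nonneg (by linarith) (by positivity)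
    have h6 : (1 - Real.sin (4 * t)) / (32 * t ^ 2) ≤ 1 / t := by
      rw [div_le_div_iff₀ (by positivity) (by positivity)]
      nlinarith
    have h7 : 1 / (8 * t) ≤ 1 / t := one_div_le_one_div_of_le (by positivity) (by linarith)
    have h8 : 0 ≤ 1 / (8 * t) := by positivity
    rw [Real.norm_eq_abs, abs_le]
    constructor <;> linarith
  have h := integral_Ioi_of_hasDerivAt_of_tendsto' hderiv hf_int hlim
  have hval : Real.sin (4 * (Real.pi / 2)) = 0 := by
    rw [show 4 * (Real.pi / 2) = 2 * Real.pi by ring, Real.sin_two_pi]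
  have hmono : ∫ t in Ioi (Real.pi / 2),
      (1 / 8 - Real.cos (4 * t) / 8 - (1 - Real.sin (4 * t)) / (16 * t)) / t ^ 2 ≤
      ∫ t in Ioi (Real.pi / 2), Real.sin (2 * t) ^ 2 / 4 / t ^ 2 := by
    refine setIntegral_mono_on hf_int (integrableOn_Ioi_div_sq (by fun_prop) half_pi_pos
      fun t _ => ?_) measurableSet_Ioi fun t ht => ?_
    · rw [abs_of_nonneg (by positivity)]
      have := Real.sin_sq_le_one (2 * t)
      linarith
    · have ht0 : 0 < t := half_pi_pos.trans ht
      have h4 : Real.cos (4 * t) = 1 - 2 * Real.sin (2 * t) ^ 2 := by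
        rw [show 4 * t = 2 * (2 * t) by ring, Real.cos_two_mul, Real.cos_sq']
        ring
      have h5 : 0 ≤ (1 - Real.sin (4 * t)) / (16 * t) :=
        div_nonneg (by linarith [Real.sin_le_one (4 * t)]) (by linarith)
      gcongr
      linarith
  rw [hval] at h
  refine le_trans (le_of_eq ?_) hmono
  rw [h]
  field_simp
  ring

lemma integral_cos_pow_four_div_sq_le :
    ∫ t in Ioi (Real.pi / 2), Real.cos t ^ 4 / t ^ 2 ≤
      2 / Real.pi - (Real.pi / 2) ^ 3 / 9 + 2 * (Real.pi / 2) ^ 5 / 225 -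
        (1 / (4 * Real.pi) - 1 / (8 * Real.pi ^ 2)) := by
  have hf_int : IntegrableOn (fun t => Real.sin (2 * t) ^ 2 / 4 / t ^ 2) (Ioi (Real.pi / 2)) := by
    refine integrableOn_Ioi_div_sq (by fun_prop) half_pi_pos fun t _ => ?_
    rw [abs_of_nonneg (by positivity)]
    have := Real.sin_sq_le_one (2 * t)
    linarith
  have h : ∫ t in Ioi (Real.pi / 2), Real.cos t ^ 4 / t ^ 2 =
      (∫ t in Ioi (Real.pi / 2), Real.cos t ^ 2 / t ^ 2) -
        ∫ t in Ioi (Real.pi / 2), Real.sin (2 * t) ^ 2 / 4 / t ^ 2 := by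
    rw [← integral_sub (integrableOn_cos_pow_div_sq 2) hf_int]
    refine integral_congr_ae (ae_of_all _ fun t => ?_)
    simp only [Real.sin_two_mul, mul_pow, Real.sin_sq]
    ring
  rw [h]
  linarith [integral_cos_sq_div_sq_le, le_integral_sin_two_mul_sq_div_sq]

end Tail
section Products

lemma one_sub_prod_le_sum_one_sub {ι : Type*} (s : Finset ι) (r : ι → ℝ)
    (h0 : ∀ i ∈ s, 0 ≤ r i) (h1 : ∀ i ∈ s, r i ≤ 1) :
    1 - ∏ i ∈ s, r i ≤ ∑ i ∈ s, (1 - r i) := by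
  classical
  induction s using Finset.induction_on with
  | empty => simp
  | insert j s hj ih =>
    rw [Finset.prod_insert hj, Finset.sum_insert hj]
    have ih := ih (fun i hi => h0 i (Finset.mem_insert_of_mem hi))
      (fun i hi => h1 i (Finset.mem_insert_of_mem hi))
    have hp : ∏ i ∈ s, r i ≤ 1 := Finset.prod_le_one
      (fun i hi => h0 i (Finset.mem_insert_of_mem hi))
      (fun i hi => h1 i (Finset.mem_insert_of_mem hi))
    have hj1 := h1 j (Finset.mem_insert_self j s)
    nlinarith

lemma prod_exp_neg_sq {n : ℕ} (a : Fin n → ℝ) (t : ℝ) :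
    ∏ i, Real.exp (-((a i * t) ^ 2 / 2)) = Real.exp (-((∑ i, a i ^ 2) / 2 * t ^ 2)) := by
  rw [← Real.exp_sum, Finset.sum_neg_distrib, Finset.sum_div, Finset.sum_mul]
  congr 2
  exact Finset.sum_congr rfl fun i _ => by ring

lemma abs_mul_le_half_pi {x t : ℝ} (hx : |x| ≤ 1) (ht : |t| ≤ Real.pi / 2) :
    |x * t| ≤ Real.pi / 2 := by
  rw [abs_mul]
  exact (mul_le_of_le_one_left (abs_nonneg t) hx).trans ht

lemma prod_cos_le_exp {n : ℕ} {a : Fin n → ℝ} (ha : ∀ i, |a i| ≤ 1) {t : ℝ}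
    (ht : |t| ≤ Real.pi / 2) :
    ∏ i, Real.cos (a i * t) ≤ Real.exp (-((∑ i, a i ^ 2) / 2 * t ^ 2)) := by
  rw [← prod_exp_neg_sq]
  refine Finset.prod_le_prod (fun i _ => ?_) fun i _ => ?_
  · exact Real.cos_nonneg_of_mem_Icc (abs_le.mp (abs_mul_le_half_pi (ha i) ht) |>.imp
      (fun h => by linarith) id)
  · exact cos_le_exp_neg_sq_div_two (abs_mul_le_half_pi (ha i) ht)

lemma exp_sub_prod_cos_le {n : ℕ} {a : Fin n → ℝ} (ha : ∀ i, |a i| ≤ 1) {t : ℝ}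
    (ht : |t| ≤ Real.pi / 2) :
    Real.exp (-((∑ i, a i ^ 2) / 2 * t ^ 2)) - ∏ i, Real.cos (a i * t) ≤
      (∑ i, a i ^ 2) / 12 * t ^ 4 * Real.exp (-((∑ i, a i ^ 2 - 1) / 2 * t ^ 2)) := by
  set s := ∑ i, a i ^ 2 with hs
  have hx := fun i => abs_mul_le_half_pi (ha i) ht
  set r : Fin n → ℝ := fun i => Real.cos (a i * t) / Real.exp (-((a i * t) ^ 2 / 2))
  have hr := one_sub_prod_le_sum_one_sub Finset.univ r
    (fun i _ => div_nonneg (Real.cos_nonneg_of_mem_Icc (abs_le.mp (hx i) |>.imp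
      (fun h => by linarith) id)) (Real.exp_pos _).le)
    (fun i _ => div_le_one_of_le₀ (cos_le_exp_neg_sq_div_two (hx i)) (Real.exp_pos _).le)
  rw [Finset.prod_div_distrib, prod_exp_neg_sq, ← hs] at hr
  have hterm : ∀ i, 1 - r i ≤ a i ^ 2 * (t ^ 4 / 12 * Real.exp (t ^ 2 / 2)) := by
    intro i
    have hE := Real.exp_pos (-((a i * t) ^ 2 / 2))
    have ha1 : a i ^ 2 ≤ 1 := (sq_le_one_iff_abs_le_one _).mpr (ha i)
    have h1 : 1 - r i = (Real.exp (-((a i * t) ^ 2 / 2)) - Real.cos (a i * t)) *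
        Real.exp ((a i * t) ^ 2 / 2) := by
      simp only [r, Real.exp_neg]
      field_simp
    have h2 : Real.exp ((a i * t) ^ 2 / 2) ≤ Real.exp (t ^ 2 / 2) := by
      apply Real.exp_le_exp.mpr
      nlinarith [sq_nonneg t]
    rw [h1]
    calc _ ≤ (a i * t) ^ 4 / 12 * Real.exp (t ^ 2 / 2) := by
          refine mul_le_mul (exp_neg_sq_div_two_sub_cos_le (hx i)) h2 (Real.exp_pos _).le
            (by positivity)
      _ ≤ _ := by
          have : (a i * t) ^ 4 ≤ a i ^ 2 * t ^ 4 := by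
            have : (0 : ℝ) ≤ t ^ 4 * a i ^ 2 * (1 - a i ^ 2) := by
              have : 0 ≤ 1 - a i ^ 2 := by linarith
              positivity
            nlinarith
          have := mul_le_mul_of_nonneg_right this (Real.exp_pos (t ^ 2 / 2)).le
          linarith
  have hsum := hr.trans (Finset.sum_le_sum fun i _ => hterm i)
  rw [← Finset.sum_mul, ← hs] at hsum
  have hE := Real.exp_pos (-(s / 2 * t ^ 2))
  have h3 := mul_le_mul_of_nonneg_left hsum hE.le
  rw [mul_sub, mul_div_cancel₀ _ hE.ne', mul_one] at h3
  refine h3.trans (le_of_eq ?_)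
  rw [show -((s - 1) / 2 * t ^ 2) = -(s / 2 * t ^ 2) + t ^ 2 / 2 by ring, Real.exp_add]
  ring

lemma abs_cos_rpow_le {p : ℕ} (hp : Even p) {s x : ℝ} (hx0 : x ≠ 0) (hx : |x| ≤ 1) (hs : p ≤ s)
    (hs0 : 0 < s) {t : ℝ} (ht : 0 < t) :
    |Real.cos (x * t)| ^ (s / x ^ 2) ≤ Real.exp (-(s / 2 * t ^ 2)) +
      (Ioi (Real.pi / 2)).indicator (fun u => Real.cos u ^ p) (|x| * t) := by
  have hx2 : 0 < x ^ 2 := by positivity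
  have hcos : Real.cos (x * t) = Real.cos (|x| * t) := by
    rw [← Real.cos_abs, abs_mul, abs_of_pos ht]
  rw [hcos]
  rcases le_or_gt (|x| * t) (Real.pi / 2) with h | h
  · rw [indicator_of_notMem (by simpa using h), add_zero]
    have hxt : abs (|x| * t) ≤ Real.pi / 2 := by rwa [abs_of_nonneg (by positivity)]
    rw [abs_of_nonneg (Real.cos_nonneg_of_mem_Icc (abs_le.mp hxt |>.imp
      (fun h => by linarith) id))]
    refine (Real.rpow_le_rpow (Real.cos_nonneg_of_mem_Icc (abs_le.mp hxt |>.imp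
      (fun h => by linarith) id)) (cos_le_exp_neg_sq_div_two hxt) (by positivity)).trans
      (le_of_eq ?_)
    rw [← Real.exp_mul, mul_pow, sq_abs]
    congr 1
    field_simp
  · rw [indicator_of_mem (mem_Ioi.mpr h), ← hp.pow_abs]
    have hps : (p : ℝ) ≤ s / x ^ 2 := by
      rw [le_div_iff₀ hx2]
      have : x ^ 2 ≤ 1 := (sq_le_one_iff_abs_le_one _).mpr hx
      have : (0 : ℝ) ≤ p := by positivity
      nlinarith
    have hpos := Real.exp_pos (-(s / 2 * t ^ 2))
    rcases (abs_nonneg (Real.cos (|x| * t))).eq_or_lt with h0 | h0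
    · rw [← h0, Real.zero_rpow (by positivity)]
      positivity
    · have := Real.rpow_le_rpow_of_exponent_ge h0 (Real.abs_cos_le_one _) hps
      rw [Real.rpow_natCast] at this
      linarith

lemma abs_prod_cos_le {n : ℕ} {a : Fin n → ℝ} (ha : ∀ i, |a i| ≤ 1) {p : ℕ} (hp : Even p)
    {s : ℝ} (hs : ∑ i, a i ^ 2 = s) (hps : p ≤ s) (hs0 : 0 < s) {t : ℝ} (ht : 0 < t) :
    |∏ i, Real.cos (a i * t)| ≤ Real.exp (-(s / 2 * t ^ 2)) + ∑ i, a i ^ 2 / s *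
      (Ioi (Real.pi / 2)).indicator (fun u => Real.cos u ^ p) (|a i| * t) := by
  have hw : ∑ i, a i ^ 2 / s = 1 := by rw [← Finset.sum_div, hs, div_self hs0.ne']
  have hamgm := Real.geom_mean_le_arith_mean_weighted Finset.univ (fun i => a i ^ 2 / s)
    (fun i => |Real.cos (a i * t)| ^ (s / a i ^ 2)) (fun i _ => by positivity) hw
    (fun i _ => by positivity)
  have hprod : ∏ i, (|Real.cos (a i * t)| ^ (s / a i ^ 2)) ^ (a i ^ 2 / s) =
      |∏ i, Real.cos (a i * t)| := by
    rw [Finset.abs_prod]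
    refine Finset.prod_congr rfl fun i _ => ?_
    rcases eq_or_ne (a i) 0 with h | h
    · simp [h]
    · rw [← Real.rpow_mul (abs_nonneg _), div_mul_div_cancel₀ (pow_ne_zero 2 h),
        div_self hs0.ne', Real.rpow_one]
  rw [← hprod]
  refine hamgm.trans ?_
  rw [show Real.exp (-(s / 2 * t ^ 2)) = ∑ i, a i ^ 2 / s * Real.exp (-(s / 2 * t ^ 2)) by
    rw [← Finset.sum_mul, hw, one_mul], ← Finset.sum_add_distrib]
  refine Finset.sum_le_sum fun i _ => ?_
  rw [← mul_add]
  rcases eq_or_ne (a i) 0 with h | h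
  · simp [h]
  · exact mul_le_mul_of_nonneg_left (abs_cos_rpow_le hp h (ha i) hps hs0 ht) (by positivity)

end Products
section Estimates

lemma integrableOn_sq_mul_exp {b : ℝ} (hb : 0 < b) :
    IntegrableOn (fun t => t ^ 2 * Real.exp (-(b * t ^ 2))) (Ioi 0) := by
  have h := integrableOn_rpow_mul_exp_neg_mul_sq hb (s := 2) (by norm_num)
  simpa only [Real.rpow_two, neg_mul] using h

lemma integral_sq_mul_exp {b : ℝ} (hb : 0 < b) :
    ∫ t in Ioi 0, t ^ 2 * Real.exp (-(b * t ^ 2)) = Real.sqrt (Real.pi / b) / (4 * b) := by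
  have h := integral_rpow_mul_exp_neg_mul_rpow (p := 2) (q := 2) two_pos (by norm_num) hb
  have hG : Real.Gamma ((2 + 1) / 2) = Real.sqrt Real.pi / 2 := by
    rw [show ((2 : ℝ) + 1) / 2 = 1 / 2 + 1 by norm_num, Real.Gamma_add_one (by norm_num),
      Real.Gamma_one_half_eq]
    ring
  have hb' : b ^ (-(2 + 1) / 2 : ℝ) = (b * Real.sqrt b)⁻¹ := by
    rw [show (-(2 + 1) / 2 : ℝ) = -(1 + 1 / 2) by norm_num, Real.rpow_neg hb.le,
      Real.rpow_add hb, Real.rpow_one, Real.sqrt_eq_rpow]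
  simp only [Real.rpow_two, neg_mul] at h
  rw [h, hG, hb', Real.sqrt_div Real.pi_pos.le]
  have := Real.sqrt_pos.mpr hb
  field_simp
  norm_num

lemma integrableOn_indicator_comp_mul_div_sq (p : ℕ) (x : ℝ) :
    IntegrableOn (fun t => (Ioi (Real.pi / 2)).indicator (fun u => Real.cos u ^ p) (|x| * t) /
      t ^ 2) (Ioi (Real.pi / 2)) := by
  refine integrableOn_Ioi_div_sq (f := fun t =>
    (Ioi (Real.pi / 2)).indicator (fun u => Real.cos u ^ p) (|x| * t)) ?_ half_pi_pos fun t _ => ?_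
  · exact (Measurable.indicator (by fun_prop) measurableSet_Ioi).comp (by fun_prop)
  · simp only [indicator_apply]
    split_ifs
    · rw [abs_pow]
      exact pow_le_one₀ (abs_nonneg _) (Real.abs_cos_le_one _)
    · simp

lemma integral_indicator_comp_mul_div_sq_le {p : ℕ} (hp : Even p) {x : ℝ} (hx : |x| ≤ 1) :
    ∫ t in Ioi (Real.pi / 2),
      (Ioi (Real.pi / 2)).indicator (fun u => Real.cos u ^ p) (|x| * t) / t ^ 2 ≤
      ∫ t in Ioi (Real.pi / 2), Real.cos t ^ p / t ^ 2 := by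
  have hT : 0 ≤ ∫ t in Ioi (Real.pi / 2), Real.cos t ^ p / t ^ 2 :=
    integral_nonneg fun t => div_nonneg (hp.pow_nonneg _) (sq_nonneg _)
  rcases eq_or_ne x 0 with rfl | hx0
  · have : ¬ Real.pi / 2 < 0 := by linarith [half_pi_pos]
    simpa [this] using hT
  have hb : 0 < |x| := abs_pos.mpr hx0
  set h : ℝ → ℝ := (Ioi (Real.pi / 2)).indicator (fun u => Real.cos u ^ p / u ^ 2) with hh
  have heq : ∀ t, (Ioi (Real.pi / 2)).indicator (fun u => Real.cos u ^ p) (|x| * t) / t ^ 2 =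
      |x| ^ 2 * h (|x| * t) := fun t => by
    simp only [hh, indicator_apply]
    split_ifs
    · rw [mul_pow, ← mul_div_assoc, mul_div_mul_left _ _ (by positivity)]
    · simp
  have hh0 : ∀ u, 0 ≤ h u := fun u =>
    indicator_nonneg (fun v _ => div_nonneg (hp.pow_nonneg _) (sq_nonneg _)) u
  have hhint : Integrable h := (integrable_indicator_iff measurableSet_Ioi).mpr
    (integrableOn_cos_pow_div_sq p)
  simp only [heq]
  rw [integral_const_mul, integral_comp_mul_left_Ioi h _ hb, smul_eq_mul]
  have hle : ∫ u in Ioi (|x| * (Real.pi / 2)), h u ≤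
      ∫ t in Ioi (Real.pi / 2), Real.cos t ^ p / t ^ 2 := by
    rw [← integral_indicator measurableSet_Ioi (f := fun t => Real.cos t ^ p / t ^ 2)]
    exact setIntegral_le_integral hhint (ae_of_all _ hh0)
  calc _ = |x| * ∫ u in Ioi (|x| * (Real.pi / 2)), h u := by field_simp
    _ ≤ |x| * ∫ t in Ioi (Real.pi / 2), Real.cos t ^ p / t ^ 2 := by gcongr
    _ ≤ _ := mul_le_of_le_one_left hT hx

lemma integrableOn_Ioi_exp_div_sq {b : ℝ} (hb : 0 ≤ b) :
    IntegrableOn (fun t => Real.exp (-(b * t ^ 2)) / t ^ 2) (Ioi (Real.pi / 2)) :=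
  integrableOn_Ioi_div_sq (by fun_prop) half_pi_pos fun t _ => by
    rw [abs_of_pos (Real.exp_pos _), Real.exp_le_one_iff, neg_nonpos]
    positivity

lemma integral_exp_div_sq_le {b : ℝ} (hb : 0 ≤ b) :
    ∫ t in Ioi (Real.pi / 2), Real.exp (-(b * t ^ 2)) / t ^ 2 ≤
      Real.exp (-(b * (Real.pi / 2) ^ 2)) * (2 / Real.pi) := by
  have h1 : IntegrableOn (fun t : ℝ => 1 / t ^ 2) (Ioi (Real.pi / 2)) :=
    integrableOn_Ioi_div_sq (by fun_prop) half_pi_pos (by simp)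
  rw [← one_div_div Real.pi 2, ← integral_Ioi_one_div_sq half_pi_pos, ← integral_const_mul]
  refine setIntegral_mono_on (integrableOn_Ioi_exp_div_sq hb) (h1.const_mul _) measurableSet_Ioi
    fun t ht => ?_
  rw [mul_one_div]
  have := half_pi_pos
  have ht' : Real.pi / 2 ≤ t := ht.le
  gcongr

lemma integrableOn_Ioi_abs_prod_cos_div_sq {n : ℕ} (a : Fin n → ℝ) :
    IntegrableOn (fun t => |∏ i, Real.cos (a i * t)| / t ^ 2) (Ioi (Real.pi / 2)) :=
  integrableOn_Ioi_div_sq (Measurable.abs (by fun_prop)) half_pi_pos fun t _ => by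
    rw [abs_abs, Finset.abs_prod]
    exact Finset.prod_le_one (fun i _ => abs_nonneg _) fun i _ => Real.abs_cos_le_one _

lemma integral_abs_prod_cos_div_sq_le {n : ℕ} {a : Fin n → ℝ} (ha : ∀ i, |a i| ≤ 1) {p : ℕ}
    (hp : Even p) {s : ℝ} (hs : ∑ i, a i ^ 2 = s) (hps : p ≤ s) (hs0 : 0 < s) :
    ∫ t in Ioi (Real.pi / 2), |∏ i, Real.cos (a i * t)| / t ^ 2 ≤
      (∫ t in Ioi (Real.pi / 2), Real.exp (-(s / 2 * t ^ 2)) / t ^ 2) +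
        ∫ t in Ioi (Real.pi / 2), Real.cos t ^ p / t ^ 2 := by
  have hG := integrableOn_Ioi_exp_div_sq (b := s / 2) (by positivity)
  have hI := fun i => (integrableOn_indicator_comp_mul_div_sq p (a i)).const_mul (a i ^ 2 / s)
  have habs := integrableOn_Ioi_abs_prod_cos_div_sq a
  calc _ ≤ ∫ t in Ioi (Real.pi / 2), (Real.exp (-(s / 2 * t ^ 2)) / t ^ 2 +
        ∑ i, a i ^ 2 / s * ((Ioi (Real.pi / 2)).indicator (fun u => Real.cos u ^ p) (|a i| * t) /
          t ^ 2)) := by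
        refine setIntegral_mono_on habs (hG.add (integrable_finsetSum _ fun i _ => hI i))
          measurableSet_Ioi fun t ht => ?_
        have ht0 : 0 < t := half_pi_pos.trans ht
        have := abs_prod_cos_le ha hp hs hps hs0 ht0
        simp only [← mul_div_assoc]
        rw [← Finset.sum_div, ← add_div]
        gcongr
    _ = (∫ t in Ioi (Real.pi / 2), Real.exp (-(s / 2 * t ^ 2)) / t ^ 2) +
        ∑ i, a i ^ 2 / s * ∫ t in Ioi (Real.pi / 2),
          (Ioi (Real.pi / 2)).indicator (fun u => Real.cos u ^ p) (|a i| * t) / t ^ 2 := by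
        rw [integral_add hG (integrable_finsetSum _ fun i _ => hI i),
          integral_finsetSum _ fun i _ => hI i]
        simp only [integral_const_mul]
    _ ≤ (∫ t in Ioi (Real.pi / 2), Real.exp (-(s / 2 * t ^ 2)) / t ^ 2) +
        ∑ i, a i ^ 2 / s * ∫ t in Ioi (Real.pi / 2), Real.cos t ^ p / t ^ 2 := by
        refine add_le_add le_rfl (Finset.sum_le_sum fun i _ => ?_)
        exact mul_le_mul_of_nonneg_left (integral_indicator_comp_mul_div_sq_le hp (ha i))
          (by positivity)
    _ = _ := by rw [← Finset.sum_mul, ← Finset.sum_div, hs, div_self hs0.ne', one_mul]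

lemma one_sub_prod_cos_eq {n : ℕ} (a : Fin n → ℝ) (t : ℝ) :
    (1 - ∏ i, Real.cos (a i * t)) / t ^ 2 =
      (∑ ε : Fin n → Bool, (1 - Real.cos ((∑ i, a i * Xpm ε i) * t)) / t ^ 2) / 2 ^ n := by
  have h := sum_signs_cos (fun i => a i * t) 0
  simp only [zero_add, Real.cos_zero, one_mul, mul_right_comm _ t, ← Finset.sum_mul] at h
  rw [← Finset.sum_div, Finset.sum_sub_distrib, h]
  simp only [Finset.sum_const, Finset.card_univ, Fintype.card_fun, Fintype.card_bool,
    Fintype.card_fin, nsmul_eq_mul, Nat.cast_pow, Nat.cast_ofNat]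
  generalize ∏ i, Real.cos (a i * t) = P
  field_simp

lemma integrableOn_one_sub_prod_cos {n : ℕ} (a : Fin n → ℝ) :
    IntegrableOn (fun t => (1 - ∏ i, Real.cos (a i * t)) / t ^ 2) (Ioi 0) := by
  simp only [one_sub_prod_cos_eq]
  exact (integrable_finsetSum _ fun ε _ => integrableOn_one_sub_cos_div_sq _).div_const _

lemma integral_one_sub_prod_cos {n : ℕ} (a : Fin n → ℝ) :
    ∫ t in Ioi 0, (1 - ∏ i, Real.cos (a i * t)) / t ^ 2 =
      Real.pi / 2 * ((∑ ε : Fin n → Bool, |∑ i, a i * Xpm ε i|) / 2 ^ n) := by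
  simp only [one_sub_prod_cos_eq]
  rw [integral_div, integral_finsetSum _ fun ε _ => integrableOn_one_sub_cos_div_sq _]
  simp only [integral_one_sub_cos_div_sq]
  rw [← Finset.mul_sum, mul_div_assoc]

lemma exp_sub_prod_cos_eq {n : ℕ} (a : Fin n → ℝ) (s t : ℝ) :
    (Real.exp (-(s / 2 * t ^ 2)) - ∏ i, Real.cos (a i * t)) / t ^ 2 =
      (1 - ∏ i, Real.cos (a i * t)) / t ^ 2 - (1 - Real.exp (-(s / 2 * t ^ 2))) / t ^ 2 := by
  ring

lemma integrableOn_exp_sub_prod_cos {n : ℕ} (a : Fin n → ℝ) {s : ℝ} (hs : 0 < s) :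
    IntegrableOn (fun t => (Real.exp (-(s / 2 * t ^ 2)) - ∏ i, Real.cos (a i * t)) / t ^ 2)
      (Ioi 0) := by
  simp only [exp_sub_prod_cos_eq]
  exact (integrableOn_one_sub_prod_cos a).sub (integrableOn_one_sub_exp_div_sq (by positivity))

lemma integral_exp_sub_prod_cos {n : ℕ} (a : Fin n → ℝ) {s : ℝ} (hs : 0 < s) :
    ∫ t in Ioi 0, (Real.exp (-(s / 2 * t ^ 2)) - ∏ i, Real.cos (a i * t)) / t ^ 2 =
      Real.pi / 2 * ((∑ ε : Fin n → Bool, |∑ i, a i * Xpm ε i|) / 2 ^ n -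
        Real.sqrt (2 / Real.pi) * Real.sqrt s) := by
  simp only [exp_sub_prod_cos_eq]
  rw [integral_sub (integrableOn_one_sub_prod_cos a)
    (integrableOn_one_sub_exp_div_sq (by positivity)), integral_one_sub_prod_cos,
    integral_one_sub_exp_div_sq (by positivity), mul_sub]
  congr 1
  rw [← Real.sqrt_mul (by positivity), ← Real.sqrt_sq half_pi_pos.le,
    ← Real.sqrt_mul (by positivity)]
  congr 1
  field_simp

lemma sqrt_mul_sub_le_of_two_le {n : ℕ} {a : Fin n → ℝ} (ha : ∀ i, |a i| ≤ 1) {s : ℝ}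
    (hs : ∑ i, a i ^ 2 = s) (hs2 : 2 ≤ s) :
    Real.pi / 2 * (Real.sqrt (2 / Real.pi) * Real.sqrt s -
      (∑ ε : Fin n → Bool, |∑ i, a i * Xpm ε i|) / 2 ^ n) ≤
      ∫ t in Ioi (Real.pi / 2), Real.cos t ^ 2 / t ^ 2 := by
  have hs0 : 0 < s := by linarith
  have hd := integrableOn_exp_sub_prod_cos a hs0
  have h := integral_exp_sub_prod_cos a hs0
  rw [integral_Ioi_eq_add hd] at h
  have hhead : 0 ≤ ∫ t in Ioc 0 (Real.pi / 2),
      (Real.exp (-(s / 2 * t ^ 2)) - ∏ i, Real.cos (a i * t)) / t ^ 2 := by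
    refine setIntegral_nonneg measurableSet_Ioc fun t ht => div_nonneg ?_ (sq_nonneg t)
    rw [← hs]
    exact sub_nonneg.mpr (prod_cos_le_exp ha (abs_le.mpr ⟨by linarith [ht.1, half_pi_pos], ht.2⟩))
  have htail : (∫ t in Ioi (Real.pi / 2), Real.exp (-(s / 2 * t ^ 2)) / t ^ 2) -
      ∫ t in Ioi (Real.pi / 2), |∏ i, Real.cos (a i * t)| / t ^ 2 ≤
      ∫ t in Ioi (Real.pi / 2),
        (Real.exp (-(s / 2 * t ^ 2)) - ∏ i, Real.cos (a i * t)) / t ^ 2 := by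
    have hG := integrableOn_Ioi_exp_div_sq (b := s / 2) (by positivity)
    have habs := integrableOn_Ioi_abs_prod_cos_div_sq a
    rw [← integral_sub hG habs]
    refine setIntegral_mono_on (hG.sub habs) (hd.mono_set (Ioi_subset_Ioi half_pi_pos.le))
      measurableSet_Ioi fun t _ => ?_
    rw [← sub_div]
    gcongr
    exact le_abs_self _
  have := integral_abs_prod_cos_div_sq_le ha even_two hs (by exact_mod_cast hs2) hs0
  linarith

lemma sub_sqrt_mul_le_of_four_le {n : ℕ} {a : Fin n → ℝ} (ha : ∀ i, |a i| ≤ 1) {s : ℝ}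
    (hs : ∑ i, a i ^ 2 = s) (hs4 : 4 ≤ s) :
    Real.pi / 2 * ((∑ ε : Fin n → Bool, |∑ i, a i * Xpm ε i|) / 2 ^ n -
      Real.sqrt (2 / Real.pi) * Real.sqrt s) ≤
      s / 12 * (Real.sqrt (Real.pi / ((s - 1) / 2)) / (4 * ((s - 1) / 2))) +
        2 * (Real.exp (-(s / 2 * (Real.pi / 2) ^ 2)) * (2 / Real.pi)) +
        ∫ t in Ioi (Real.pi / 2), Real.cos t ^ 4 / t ^ 2 := by
  have hs0 : 0 < s := by linarith
  have hd := integrableOn_exp_sub_prod_cos a hs0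
  have h := integral_exp_sub_prod_cos a hs0
  rw [integral_Ioi_eq_add hd] at h
  have hb : 0 < (s - 1) / 2 := by linarith
  have hsq := (integrableOn_sq_mul_exp hb).const_mul (s / 12)
  have hhead : ∫ t in Ioc 0 (Real.pi / 2),
      (Real.exp (-(s / 2 * t ^ 2)) - ∏ i, Real.cos (a i * t)) / t ^ 2 ≤
      s / 12 * (Real.sqrt (Real.pi / ((s - 1) / 2)) / (4 * ((s - 1) / 2))) := by
    rw [← integral_sq_mul_exp hb, ← integral_const_mul]
    refine (setIntegral_mono_on (hd.mono_set Ioc_subset_Ioi_self)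
      (IntegrableOn.mono_set hsq Ioc_subset_Ioi_self) measurableSet_Ioc fun t ht => ?_).trans
      (setIntegral_mono_set hsq (ae_of_all _ fun t => ?_) Ioc_subset_Ioi_self.eventuallyLE)
    · rw [div_le_iff₀ (pow_pos ht.1 2)]
      have := exp_sub_prod_cos_le ha (abs_le.mpr ⟨by linarith [ht.1, half_pi_pos], ht.2⟩)
      rw [hs] at this
      refine this.trans (le_of_eq (by ring))
    · simp only [Pi.zero_apply]
      positivity
  have htail : ∫ t in Ioi (Real.pi / 2),
        (Real.exp (-(s / 2 * t ^ 2)) - ∏ i, Real.cos (a i * t)) / t ^ 2 ≤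
      (∫ t in Ioi (Real.pi / 2), Real.exp (-(s / 2 * t ^ 2)) / t ^ 2) +
      ∫ t in Ioi (Real.pi / 2), |∏ i, Real.cos (a i * t)| / t ^ 2 := by
    have hG := integrableOn_Ioi_exp_div_sq (b := s / 2) (by positivity)
    have habs := integrableOn_Ioi_abs_prod_cos_div_sq a
    rw [← integral_add hG habs]
    refine setIntegral_mono_on (hd.mono_set (Ioi_subset_Ioi half_pi_pos.le)) (hG.add habs)
      measurableSet_Ioi fun t _ => ?_
    rw [← add_div, sub_eq_add_neg]
    gcongr
    exact neg_le_abs _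
  have h1 := integral_abs_prod_cos_div_sq_le ha (p := 4) (by decide) hs
    (by exact_mod_cast hs4) hs0
  have h2 := integral_exp_div_sq_le (b := s / 2) (by positivity)
  linarith

end Estimates
section Main

lemma sqrt_two_div_pi_mem_Ioo : Real.sqrt (2 / Real.pi) ∈ Ioo 0.797 0.798 := by
  have h1 := Real.pi_gt_d4
  have h2 := Real.pi_lt_d4
  constructor
  · apply Real.lt_sqrt_of_sq_lt
    rw [lt_div_iff₀ Real.pi_pos]
    linarith
  · rw [Real.sqrt_lt' (by norm_num), div_lt_iff₀ Real.pi_pos]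
    linarith

lemma half_pi_mem_Ioo : Real.pi / 2 ∈ Ioo 1.57 1.571 := by
  constructor <;> linarith [Real.pi_gt_d4, Real.pi_lt_d4]

lemma two_div_pi_sub_half_pi_pow_le :
    2 / Real.pi - (Real.pi / 2) ^ 3 / 9 + 2 * (Real.pi / 2) ^ 5 / 225 ≤ 0.293 := by
  obtain ⟨h1, h2⟩ := half_pi_mem_Ioo
  have h3 : 2 / Real.pi ≤ 0.637 := by
    rw [div_le_iff₀ Real.pi_pos]
    linarith
  have h4 : (1.57 : ℝ) ^ 3 ≤ (Real.pi / 2) ^ 3 := by gcongr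
  have h5 : (Real.pi / 2) ^ 5 ≤ (1.571 : ℝ) ^ 5 := by gcongr
  norm_num at h3 h4 h5 ⊢
  linarith

lemma integral_cos_sq_div_sq_le_num :
    ∫ t in Ioi (Real.pi / 2), Real.cos t ^ 2 / t ^ 2 ≤ 0.293 :=
  integral_cos_sq_div_sq_le.trans two_div_pi_sub_half_pi_pow_le

lemma integral_cos_pow_four_div_sq_le_num :
    ∫ t in Ioi (Real.pi / 2), Real.cos t ^ 4 / t ^ 2 ≤ 0.228 := by
  have h := integral_cos_pow_four_div_sq_le
  have h1 := two_div_pi_sub_half_pi_pow_le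
  have h2 : 0.065 ≤ 1 / (4 * Real.pi) - 1 / (8 * Real.pi ^ 2) := by
    rw [show 1 / (4 * Real.pi) - 1 / (8 * Real.pi ^ 2) =
      (2 * Real.pi - 1) / (8 * Real.pi ^ 2) by field_simp; ring, le_div_iff₀ (by positivity)]
    nlinarith [Real.pi_gt_d4, Real.pi_lt_d4]
  linarith

lemma sqrt_mul_sub_le {n : ℕ} {a : Fin n → ℝ} (ha : ∀ i, |a i| ≤ 1) {k : Fin n}
    (hk : |a k| = 1) :
    Real.sqrt (2 / Real.pi) * Real.sqrt (∑ i, a i ^ 2) -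
      (∑ ε : Fin n → Bool, |∑ i, a i * Xpm ε i|) / 2 ^ n ≤ 1 - Real.sqrt (2 / Real.pi) := by
  obtain ⟨hc1, hc2⟩ := sqrt_two_div_pi_mem_Ioo
  rcases le_total (∑ i, a i ^ 2) 2 with hs | hs
  · have h1 : 1 ≤ (∑ ε : Fin n → Bool, |∑ i, a i * Xpm ε i|) / 2 ^ n := by
      rw [le_div_iff₀ (by positivity), one_mul]
      exact one_le_sum_signs_abs a k hk
    have h2 : Real.sqrt (∑ i, a i ^ 2) ≤ 1.5 :=
      Real.sqrt_le_iff.mpr ⟨by norm_num, hs.trans (by norm_num)⟩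
    nlinarith
  · have h := sqrt_mul_sub_le_of_two_le ha rfl hs
    have h1 := integral_cos_sq_div_sq_le_num
    obtain ⟨hp, -⟩ := half_pi_mem_Ioo
    by_contra! hlt
    nlinarith

lemma sub_sqrt_mul_le {n : ℕ} {a : Fin n → ℝ} (ha : ∀ i, |a i| ≤ 1) {k : Fin n}
    (hk : |a k| = 1) :
    (∑ ε : Fin n → Bool, |∑ i, a i * Xpm ε i|) / 2 ^ n -
      Real.sqrt (2 / Real.pi) * Real.sqrt (∑ i, a i ^ 2) ≤ 1 - Real.sqrt (2 / Real.pi) := by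
  obtain ⟨hc1, hc2⟩ := sqrt_two_div_pi_mem_Ioo
  have hs1 : 1 ≤ ∑ i, a i ^ 2 := by
    have := Finset.single_le_sum (f := fun i => a i ^ 2) (fun i _ => sq_nonneg (a i))
      (Finset.mem_univ k)
    simpa [← sq_abs (a k), hk] using this
  rcases le_total (∑ i, a i ^ 2) 4.5 with hs | hs
  · have h1 : (∑ ε : Fin n → Bool, |∑ i, a i * Xpm ε i|) / 2 ^ n ≤
        1 + (∑ i, a i ^ 2 - 1) / 4 := by
      rw [div_le_iff₀' (by positivity)]
      exact sum_signs_abs_le a k hk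
    have h2 : Real.sqrt (∑ i, a i ^ 2) ≤ 2.15 :=
      Real.sqrt_le_iff.mpr ⟨by norm_num, hs.trans (by norm_num)⟩
    have h3 : 1 ≤ Real.sqrt (∑ i, a i ^ 2) := Real.one_le_sqrt.mpr hs1
    have h4 := Real.sq_sqrt (zero_le_one.trans hs1)
    nlinarith
  · have h := sub_sqrt_mul_le_of_four_le ha rfl (le_trans (by norm_num) hs)
    set s := ∑ i, a i ^ 2
    have hT := integral_cos_pow_four_div_sq_le_num
    obtain ⟨hp1, hp2⟩ := half_pi_mem_Ioo
    have hsqrt : Real.sqrt (Real.pi / ((s - 1) / 2)) ≤ 1.341 := by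
      refine Real.sqrt_le_iff.mpr ⟨by norm_num, ?_⟩
      rw [div_le_iff₀ (by linarith)]
      norm_num at hs hp2 ⊢
      linarith
    have hhead : s / 12 * (Real.sqrt (Real.pi / ((s - 1) / 2)) / (4 * ((s - 1) / 2))) ≤
        0.072 := by
      rw [← mul_div_assoc, div_le_iff₀ (by linarith)]
      nlinarith
    have hexp : Real.exp (-(s / 2 * (Real.pi / 2) ^ 2)) ≤ 0.007 := by
      have h5 : Real.exp 5 = Real.exp 1 ^ 5 := by rw [← Real.exp_nat_mul]; norm_num
      have h6 : (2.718 : ℝ) ^ 5 ≤ Real.exp 1 ^ 5 := by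
        gcongr
        exact le_trans (by norm_num) Real.exp_one_gt_d9.le
      have h7 : Real.exp 5 ≤ Real.exp (s / 2 * (Real.pi / 2) ^ 2) := by
        apply Real.exp_le_exp.mpr
        nlinarith
      rw [Real.exp_neg]
      exact inv_le_of_inv_le₀ (by norm_num)
        (le_trans (by norm_num) (h6.trans (h5.symm.le.trans h7)))
    have hpi : 2 / Real.pi ≤ 0.637 := by
      rw [div_le_iff₀ Real.pi_pos]
      linarith
    have hprod : Real.exp (-(s / 2 * (Real.pi / 2) ^ 2)) * (2 / Real.pi) ≤ 0.007 * 0.637 :=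
      mul_le_mul hexp hpi (by positivity) (by norm_num)
    by_contra! hlt
    nlinarith

lemma abs_sub_sqrt_mul_le_of_abs_eq_one {n : ℕ} {a : Fin n → ℝ} (ha : ∀ i, |a i| ≤ 1)
    {k : Fin n} (hk : |a k| = 1) :
    |(∑ ε : Fin n → Bool, |∑ i, a i * Xpm ε i|) / 2 ^ n -
      Real.sqrt (2 / Real.pi) * Real.sqrt (∑ i, a i ^ 2)| ≤ 1 - Real.sqrt (2 / Real.pi) := by
  rw [abs_sub_le_iff]
  exact ⟨sub_sqrt_mul_le ha hk, sqrt_mul_sub_le ha hk⟩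

end Main
/-- König–Schütt–Tomczak-Jaegermann inequality (real case):
`|E[|∑ aᵢξᵢ|] − √(2/π)‖a‖₂| ≤ (1 − √(2/π))‖a‖_∞` for ξ uniform on `{-1,1}^n`. -/
theorem konig_schutt_tomczak_real {n : ℕ} (a : Fin n → ℝ) :
    |(∑ ε : Fin n → Bool, |∑ i, a i * Xpm ε i|) / 2 ^ n -
        Real.sqrt (2 / Real.pi) * Real.sqrt (∑ i, a i ^ 2)| ≤
      (1 - Real.sqrt (2 / Real.pi)) * ⨆ i, |a i| := by
  rcases isEmpty_or_nonempty (Fin n) with hn | hn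
  · simp
  obtain ⟨k, hk⟩ := exists_eq_ciSup_of_finite (f := fun i => |a i|)
  have hle : ∀ i, |a i| ≤ |a k| := fun i =>
    (le_ciSup (Set.finite_range _).bddAbove i).trans hk.ge
  rw [← hk]
  rcases (abs_nonneg (a k)).eq_or_lt with h0 | h0
  · have ha : ∀ i, a i = 0 := fun i => abs_nonpos_iff.mp (h0 ▸ hle i)
    simp [ha]
  set m := |a k|
  have h := abs_sub_sqrt_mul_le_of_abs_eq_one (a := fun i => a i / m) (k := k)
    (fun i => by rw [abs_div, abs_of_pos h0]; exact div_le_one_of_le₀ (hle i) h0.le)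
    (by rw [abs_div, abs_of_pos h0]; exact div_self h0.ne')
  have hsum : ∑ ε : Fin n → Bool, |∑ i, a i * Xpm ε i| =
      m * ∑ ε : Fin n → Bool, |∑ i, a i / m * Xpm ε i| := by
    rw [Finset.mul_sum]
    refine Finset.sum_congr rfl fun ε _ => ?_
    rw [← abs_of_pos h0, ← abs_mul, abs_of_pos h0, Finset.mul_sum]
    congr 1
    exact Finset.sum_congr rfl fun i _ => by field_simp
  have hsqrt : Real.sqrt (∑ i, a i ^ 2) = m * Real.sqrt (∑ i, (a i / m) ^ 2) := by
    rw [← Real.sqrt_sq h0.le, ← Real.sqrt_mul (sq_nonneg m), Real.sqrt_sq h0.le, Finset.mul_sum]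
    congr 1
    exact Finset.sum_congr rfl fun i _ => by field_simp
  rw [hsum, hsqrt, mul_div_assoc, mul_left_comm, ← mul_sub, abs_mul, abs_of_pos h0, mul_comm m]
  exact mul_le_mul_of_nonneg_right h h0.le
end

section
/- Let A be an n×n real matrix with ‖A‖₂ ≤ T, T ≠ 0. Then |perm(A)| ≤ T^n (n+6)·exp(−√(n(1 − h_∞(A)/T))/400), where h_∞(A) = (1/n) ∑_i ‖r_i‖_∞ over rows r_i. -/
/-- The permanent of a real square matrix. -/
noncomputable def permR {n : ℕ} (A : Matrix (Fin n) (Fin n) ℝ) : ℝ :=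
  ∑ σ : Equiv.Perm (Fin n), ∏ i, A i (σ i)

/-- The operator 2-norm of a real square matrix. -/
noncomputable def opNormR {n : ℕ} (A : Matrix (Fin n) (Fin n) ℝ) : ℝ :=
  ‖LinearMap.toContinuousLinearMap (Matrix.toEuclideanLin A)‖

/-- Average of the ℓ∞-norms of the rows of A. -/
noncomputable def hInfR {n : ℕ} (A : Matrix (Fin n) (Fin n) ℝ) : ℝ :=
  (∑ i, ⨆ j, |A i j|) / n

open scoped BigOperators ComplexConjugate

/-- Translation invariance of the uniform average on a finite group. -/
lemma expect_add_right {G : Type*} [AddGroup G] [Fintype G] (f : G → ℝ) (g : G) :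
    𝔼 x : G, f (x + g) = 𝔼 x : G, f x :=
  Fintype.expect_equiv (Equiv.addRight g) _ _ fun _ => rfl

/-- Averaging over an extra rotation of a single coordinate does not change the mean. -/
lemma expect_expect_add_single {ι G : Type*} [Fintype ι] [DecidableEq ι] [AddGroup G] [Fintype G]
    (f : (ι → G) → ℝ) (a : ι) :
    𝔼 X, f X = 𝔼 X : ι → G, 𝔼 c : G, f (X + Pi.single a c) := by
  rw [Finset.expect_comm]
  simp_rw [expect_add_right f]
  rw [Fintype.expect_const]

lemma stdAddChar_nsmul_one_ne_one {m : ℕ} [NeZero m] {k : ℕ} (hk : 0 < k) (hkm : k < m) :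
    (ZMod.stdAddChar (N := m)) (k : ZMod m) ≠ 1 := by
  intro h
  have h0 : (k : ZMod m) = 0 := by
    apply ZMod.injective_stdAddChar
    rw [h, AddChar.map_zero_eq_one]
  rw [ZMod.natCast_eq_zero_iff] at h0
  exact absurd (Nat.le_of_dvd hk h0) (by omega)

lemma expect_stdAddChar_pow {m : ℕ} [NeZero m] {k : ℕ} (hk : 0 < k) (hkm : k < m) :
    𝔼 c : ZMod m, ZMod.stdAddChar c ^ k = 0 := by
  set g : ℂ := 𝔼 c : ZMod m, ZMod.stdAddChar c ^ k with hg
  have h : g = g * ZMod.stdAddChar (k : ZMod m) := by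
    rw [hg, Finset.expect_mul]
    refine (Fintype.expect_equiv (Equiv.addRight (1 : ZMod m)) _ _ fun c => ?_).symm
    simp only [Equiv.coe_addRight, AddChar.map_add_eq_mul, mul_pow, ← AddChar.map_nsmul_eq_pow]
    simp
  by_contra h0
  exact stdAddChar_nsmul_one_ne_one hk hkm (mul_left_cancel₀ h0 (by rw [← h, mul_one]))

lemma norm_stdAddChar {m : ℕ} [NeZero m] (c : ZMod m) : ‖ZMod.stdAddChar c‖ = 1 := by
  rw [ZMod.stdAddChar_apply]; exact Circle.norm_coe _

lemma expect_re_mul_pow {m : ℕ} [NeZero m] {k : ℕ} (hk : 0 < k) (hkm : k < m) (b : ℂ) :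
    𝔼 c : ZMod m, (b * ZMod.stdAddChar c ^ k).re = 0 := by
  have h := map_expect (Complex.reLm.restrictScalars ℚ≥0)
    (fun c : ZMod m => b * ZMod.stdAddChar c ^ k) Finset.univ
  rw [← Finset.mul_expect, expect_stdAddChar_pow hk hkm, mul_zero, map_zero] at h
  exact h.symm

lemma two_re_sq (z : ℂ) : (2 * z.re) ^ 2 = 2 * ‖z‖ ^ 2 + 2 * (z ^ 2).re := by
  rw [← Complex.normSq_eq_norm_sq, Complex.normSq_apply]
  simp [pow_two]; ring

lemma two_re_cube (z : ℂ) : (2 * z.re) ^ 3 = 6 * ‖z‖ ^ 2 * z.re + 2 * (z ^ 3).re := by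
  rw [← Complex.normSq_eq_norm_sq, Complex.normSq_apply]
  simp [pow_succ]; ring

lemma expect_add_re {m : ℕ} [NeZero m] (hm : 1 < m) (R : ℝ) (b : ℂ) :
    𝔼 c : ZMod m, (R + 2 * (b * ZMod.stdAddChar c).re) = R := by
  have h1 := expect_re_mul_pow one_pos hm b
  simp only [pow_one] at h1
  rw [Finset.expect_add_distrib, ← Finset.mul_expect, h1, Fintype.expect_const]; simp

lemma expect_add_re_sq {m : ℕ} [NeZero m] (hm : 2 < m) (R : ℝ) (b : ℂ) :
    𝔼 c : ZMod m, (R + 2 * (b * ZMod.stdAddChar c).re) ^ 2 = R ^ 2 + 2 * ‖b‖ ^ 2 := by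
  have h1 := expect_re_mul_pow one_pos (by omega : 1 < m) b
  have h2 := expect_re_mul_pow two_pos hm (b ^ 2)
  have key : ∀ c : ZMod m, (R + 2 * (b * ZMod.stdAddChar c).re) ^ 2 =
      (R ^ 2 + 2 * ‖b‖ ^ 2) + (4 * R * (b * ZMod.stdAddChar c ^ 1).re
        + 2 * (b ^ 2 * ZMod.stdAddChar c ^ 2).re) := by
    intro c
    have := two_re_sq (b * ZMod.stdAddChar c)
    rw [mul_pow b, norm_mul, norm_stdAddChar, mul_one] at this
    rw [pow_one]
    linear_combination this
  simp_rw [key]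
  rw [Finset.expect_add_distrib, Fintype.expect_const, Finset.expect_add_distrib,
    ← Finset.mul_expect, ← Finset.mul_expect, h1, h2]; simp

lemma expect_add_re_cube {m : ℕ} [NeZero m] (hm : 3 < m) (R : ℝ) (b : ℂ) :
    𝔼 c : ZMod m, (R + 2 * (b * ZMod.stdAddChar c).re) ^ 3 = R ^ 3 + 6 * R * ‖b‖ ^ 2 := by
  have h1 := expect_re_mul_pow one_pos (by omega : 1 < m) b
  have h2 := expect_re_mul_pow two_pos (by omega : 2 < m) (b ^ 2)
  have h3 := expect_re_mul_pow three_pos hm (b ^ 3)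
  have key : ∀ c : ZMod m, (R + 2 * (b * ZMod.stdAddChar c).re) ^ 3 =
      (R ^ 3 + 6 * R * ‖b‖ ^ 2) + ((6 * R ^ 2 + 6 * ‖b‖ ^ 2) * (b * ZMod.stdAddChar c ^ 1).re
        + 6 * R * (b ^ 2 * ZMod.stdAddChar c ^ 2).re
        + 2 * (b ^ 3 * ZMod.stdAddChar c ^ 3).re) := by
    intro c
    have e2 := two_re_sq (b * ZMod.stdAddChar c)
    have e3 := two_re_cube (b * ZMod.stdAddChar c)
    rw [mul_pow b, norm_mul, norm_stdAddChar, mul_one] at e2 e3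
    rw [pow_one]
    linear_combination 3 * R * e2 + e3
  simp_rw [key]
  rw [Finset.expect_add_distrib, Fintype.expect_const, Finset.expect_add_distrib,
    Finset.expect_add_distrib, ← Finset.mul_expect, ← Finset.mul_expect, ← Finset.mul_expect,
    h1, h2, h3]; simp

/-- The partial sum over `S` of the coefficients `r` rotated by the phases `X`. -/
noncomputable def phaseSum {ι : Type*} {m : ℕ} [NeZero m] (r : ι → ℝ) (S : Finset ι)
    (X : ι → ZMod m) : ℂ := ∑ j ∈ S, (r j : ℂ) * ZMod.stdAddChar (X j)

/-- Deviation of the squared modulus of `phaseSum` from its mean. -/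
noncomputable def phaseDev {ι : Type*} {m : ℕ} [NeZero m] (r : ι → ℝ) (S : Finset ι)
    (X : ι → ZMod m) : ℝ := ‖phaseSum r S X‖ ^ 2 - ∑ j ∈ S, r j ^ 2

lemma phaseDev_insert {ι : Type*} [DecidableEq ι] {m : ℕ} [NeZero m] (r : ι → ℝ)
    (S : Finset ι) {a : ι} (ha : a ∉ S) (X : ι → ZMod m) (c : ZMod m) :
    phaseDev r (insert a S) (X + Pi.single a c) = phaseDev r S X +
      2 * ((r a * conj (phaseSum r S X) * ZMod.stdAddChar (X a)) * ZMod.stdAddChar c).re := by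
  have hS : phaseSum r S (X + Pi.single a c) = phaseSum r S X := by
    refine Finset.sum_congr rfl fun j hj => ?_
    have : j ≠ a := fun h => ha (h ▸ hj)
    simp only [Pi.add_apply, Pi.single_eq_of_ne this, add_zero]
  have hi : phaseSum r (insert a S) (X + Pi.single a c) =
      phaseSum r S X + r a * (ZMod.stdAddChar (X a) * ZMod.stdAddChar c) := by
    rw [← hS]
    simp only [phaseSum]
    rw [Finset.sum_insert ha, Pi.add_apply, Pi.single_eq_same, AddChar.map_add_eq_mul, add_comm]
  have hn : ‖(r a : ℂ) * (ZMod.stdAddChar (X a) * ZMod.stdAddChar c)‖ ^ 2 = r a ^ 2 := by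
    simp
  have hadd : ∀ v w : ℂ, ‖v + w‖ ^ 2 = ‖v‖ ^ 2 + ‖w‖ ^ 2 + 2 * (conj v * w).re := by
    intro v w
    simp only [← Complex.normSq_eq_norm_sq, Complex.normSq_apply]
    simp; ring
  rw [phaseDev, phaseDev, hi, hadd, hn, Finset.sum_insert ha]
  have : conj (phaseSum r S X) * (r a * (ZMod.stdAddChar (X a) * ZMod.stdAddChar c)) =
    (r a * conj (phaseSum r S X) * ZMod.stdAddChar (X a)) * ZMod.stdAddChar c := by ring
  rw [this]; ring

/-- The variance of the squared modulus of `phaseSum`. -/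
def phaseVar {ι : Type*} (r : ι → ℝ) (S : Finset ι) : ℝ :=
  (∑ j ∈ S, r j ^ 2) ^ 2 - ∑ j ∈ S, r j ^ 4

lemma phaseDev_moments {ι : Type*} [Fintype ι] [DecidableEq ι] {m : ℕ} [NeZero m] (hm : 3 < m)
    (r : ι → ℝ) (S : Finset ι) :
    𝔼 X : ι → ZMod m, phaseDev r S X = 0 ∧
    𝔼 X : ι → ZMod m, phaseDev r S X ^ 2 = phaseVar r S ∧
    𝔼 X : ι → ZMod m, phaseDev r S X ^ 3 ≤ 6 * (∑ j ∈ S, r j ^ 2) * phaseVar r S ∧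
    0 ≤ phaseVar r S := by
  induction S using Finset.induction_on with
  | empty => simp [phaseDev, phaseSum, phaseVar]
  | insert a S ha ih =>
    obtain ⟨h1, h2, h3, h0⟩ := ih
    set s := ∑ j ∈ S, r j ^ 2 with hs
    have hs0 : 0 ≤ s := Finset.sum_nonneg fun j _ => sq_nonneg _
    have hvar : phaseVar r (insert a S) = phaseVar r S + 2 * r a ^ 2 * s := by
      simp only [phaseVar, Finset.sum_insert ha, ← hs]; ring
    have hb : ∀ X : ι → ZMod m,
        ‖(r a : ℂ) * conj (phaseSum r S X) * ZMod.stdAddChar (X a)‖ ^ 2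
          = r a ^ 2 * (phaseDev r S X + s) := by
      intro X
      simp [phaseDev, mul_pow, ← hs]
    refine ⟨?_, ?_, ?_, ?_⟩
    · rw [expect_expect_add_single _ a]
      simp_rw [phaseDev_insert r S ha, expect_add_re (by omega : 1 < m)]
      exact h1
    · rw [expect_expect_add_single _ a]
      simp_rw [phaseDev_insert r S ha, expect_add_re_sq (by omega : 2 < m), hb]
      rw [Finset.expect_add_distrib, ← Finset.mul_expect, ← Finset.mul_expect,
        Finset.expect_add_distrib, h1, h2, Fintype.expect_const, hvar]; ring
    · rw [expect_expect_add_single _ a]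
      simp_rw [phaseDev_insert r S ha, expect_add_re_cube hm, hb]
      have : ∀ X : ι → ZMod m, phaseDev r S X ^ 3
          + 6 * phaseDev r S X * (r a ^ 2 * (phaseDev r S X + s)) = phaseDev r S X ^ 3 +
            (6 * r a ^ 2 * phaseDev r S X ^ 2 + 6 * r a ^ 2 * s * phaseDev r S X) := by
        intro X; ring
      simp_rw [this]
      rw [Finset.expect_add_distrib, Finset.expect_add_distrib, ← Finset.mul_expect,
        ← Finset.mul_expect, h1, h2, Finset.sum_insert ha, ← hs, hvar]
      nlinarith [mul_nonneg (sq_nonneg (r a)) hs0, mul_nonneg (mul_nonneg (sq_nonneg (r a)) hs0) hs0,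
        mul_nonneg (mul_nonneg (sq_nonneg (r a)) hs0) (sq_nonneg (r a))]
    · rw [hvar]; positivity

/-- The mean modulus of a random-phase sum is bounded away from one unless the sum is dominated
by a single coefficient of modulus close to one. -/
lemma one_sub_le_expect_one_sub_norm {ι : Type*} [Fintype ι] [DecidableEq ι] {m : ℕ} [NeZero m]
    (hm : 3 < m) (r : ι → ℝ) (hr : ∑ j, r j ^ 2 ≤ 1) (M : ℝ) (hM : ∀ j, |r j| ≤ M) (hM0 : 0 ≤ M) :
    (1 - M) / 64 ≤ 𝔼 X : ι → ZMod m, (1 - ‖phaseSum r Finset.univ X‖) := by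
  obtain ⟨h1, h2, h3, h0⟩ := phaseDev_moments hm r Finset.univ
  set s := ∑ j, r j ^ 2 with hs
  set Q := phaseVar r Finset.univ with hQ
  have hs0 : 0 ≤ s := Finset.sum_nonneg fun j _ => sq_nonneg _
  have hpt : ∀ X : ι → ZMod m, (1 - s) / 2 + (1 - s) ^ 2 / 16 + (1 - s) ^ 3 / 192
      + (-(1 / 2) - (1 - s) / 8 - (1 - s) ^ 2 / 64) * phaseDev r Finset.univ X
      + (1 / 16 + (1 - s) / 64) * phaseDev r Finset.univ X ^ 2
      + (-(1 / 192)) * phaseDev r Finset.univ X ^ 3 ≤ 1 - ‖phaseSum r Finset.univ X‖ := by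
    intro X
    have hR : phaseDev r Finset.univ X = ‖phaseSum r Finset.univ X‖ ^ 2 - s := rfl
    have hy := norm_nonneg (phaseSum r Finset.univ X)
    rw [hR]
    generalize ‖phaseSum r Finset.univ X‖ = y at hy ⊢
    have hq : (y + 1) ^ 2 * (13 - y ^ 2) ≤ 96 := by
      nlinarith [sq_nonneg (y ^ 2 + y - 8), sq_nonneg (y - 2), sq_nonneg (y - 5/2),
        mul_nonneg hy (sq_nonneg (y - 2)), mul_nonneg hy (sq_nonneg (y - 5/2)), sq_nonneg (y ^ 2 - 5)]
    nlinarith [mul_nonneg (sq_nonneg (y - 1)) (sub_nonneg.2 hq)]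
  have hE := Finset.expect_le_expect (s := Finset.univ) fun X _ => hpt X
  refine le_trans ?_ hE
  rw [Finset.expect_add_distrib, Finset.expect_add_distrib, Finset.expect_add_distrib,
    ← Finset.mul_expect, ← Finset.mul_expect, ← Finset.mul_expect, h1, h2, Fintype.expect_const]
  have hQs : s ^ 2 - M ^ 2 * s ≤ Q := by
    have : ∑ j, r j ^ 4 ≤ M ^ 2 * s := by
      rw [hs, Finset.mul_sum]
      refine Finset.sum_le_sum fun j _ => ?_
      have : r j ^ 2 ≤ M ^ 2 := by
        rw [← sq_abs]; exact pow_le_pow_left₀ (abs_nonneg _) (hM j) 2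
      nlinarith [sq_nonneg (r j)]
    rw [hQ, phaseVar, ← hs]; linarith
  have hM1 : 1 - M ≤ 2 * (1 - s) + 2 * Q := by
    by_cases hM' : 1 ≤ M
    · linarith
    push Not at hM'
    by_cases hs' : s ≤ 1 / 2
    · linarith
    push Not at hs'
    nlinarith
  have h3' : 𝔼 X : ι → ZMod m, phaseDev r Finset.univ X ^ 3 ≤ 6 * Q := by nlinarith
  have := mul_nonneg (sub_nonneg.2 hr) h0
  have := pow_nonneg (sub_nonneg.2 hr) 3
  nlinarith [sq_nonneg (1 - s)]

lemma expect_phase_prod {ι : Type*} [Fintype ι] [DecidableEq ι] {m : ℕ} [NeZero m] (hm : 1 < m)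
    (p : ι → ι) [Decidable (Function.Bijective p)] :
    𝔼 X : ι → ZMod m, ((∏ j, conj (ZMod.stdAddChar (X j))) * ∏ i, ZMod.stdAddChar (X (p i)))
      = if Function.Bijective p then 1 else 0 := by
  split_ifs with hp
  · have : ∀ X : ι → ZMod m,
        (∏ j, conj (ZMod.stdAddChar (X j))) * ∏ i, ZMod.stdAddChar (X (p i)) = 1 := by
      intro X
      rw [hp.prod_comp (fun j => ZMod.stdAddChar (X j)), ← Finset.prod_mul_distrib]
      refine Finset.prod_eq_one fun j _ => ?_
      rw [← Complex.normSq_eq_conj_mul_self, Complex.normSq_eq_norm_sq, norm_stdAddChar]; simp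
    simp_rw [this]
    rw [Fintype.expect_const]
  · have hs : ¬ Function.Surjective p := fun h => hp (Finite.surjective_iff_bijective.1 h)
    obtain ⟨a, ha⟩ : ∃ a, ∀ i, p i ≠ a := by
      simpa [Function.Surjective] using hs
    set g : ℂ := 𝔼 X : ι → ZMod m,
      ((∏ j, conj (ZMod.stdAddChar (X j))) * ∏ i, ZMod.stdAddChar (X (p i))) with hg
    have hshift : g = g * conj (ZMod.stdAddChar (1 : ZMod m)) := by
      rw [hg, Finset.expect_mul]
      refine (Fintype.expect_equiv (Equiv.addRight (Pi.single a (1 : ZMod m))) _ _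
        fun X => ?_).symm
      have h1 : ∀ i, (X + Pi.single a (1 : ZMod m) : ι → ZMod m) (p i) = X (p i) := fun i => by
        rw [Pi.add_apply, Pi.single_eq_of_ne (ha i), add_zero]
      have h2 : ∏ j, conj (ZMod.stdAddChar ((X + Pi.single a (1 : ZMod m) : ι → ZMod m) j)) =
          (∏ j, conj (ZMod.stdAddChar (X j))) * conj (ZMod.stdAddChar (1 : ZMod m)) := by
        simp only [Pi.add_apply, AddChar.map_add_eq_mul, map_mul, Finset.prod_mul_distrib]
        congr 1
        rw [Finset.prod_eq_single a]
        · rw [Pi.single_eq_same]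
        · intro j _ hj
          rw [Pi.single_eq_of_ne hj, AddChar.map_zero_eq_one, map_one]
        · simp
      simp only [Equiv.coe_addRight, h1, h2]
      ring
    by_contra h0
    have h1 : conj (ZMod.stdAddChar (1 : ZMod m)) = 1 :=
      mul_left_cancel₀ h0 (by rw [← hshift, mul_one])
    have h2 := stdAddChar_nsmul_one_ne_one (m := m) one_pos hm
    apply h2
    have := congrArg conj h1
    simpa using this

/-- Glynn's formula: the permanent as an average over independent random phases. -/
lemma expect_phase_eq_permanent {ι : Type*} [Fintype ι] [DecidableEq ι] {m : ℕ} [NeZero m]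
    (hm : 1 < m) (A : ι → ι → ℝ) :
    𝔼 X : ι → ZMod m, ((∏ j, conj (ZMod.stdAddChar (X j))) *
      ∏ i, phaseSum (A i) Finset.univ X) = ((∑ σ : Equiv.Perm ι, ∏ i, A i (σ i) : ℝ) : ℂ) := by
  classical
  have h1 : ∀ X : ι → ZMod m, (∏ j, conj (ZMod.stdAddChar (X j))) *
      ∏ i, phaseSum (A i) Finset.univ X = ∑ p : ι → ι, (∏ i, (A i (p i) : ℂ)) *
        ((∏ j, conj (ZMod.stdAddChar (X j))) * ∏ i, ZMod.stdAddChar (X (p i))) := by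
    intro X
    simp only [phaseSum]
    rw [Finset.prod_univ_sum, Fintype.piFinset_univ, Finset.mul_sum]
    refine Finset.sum_congr rfl fun p _ => ?_
    rw [Finset.prod_mul_distrib]; ring
  simp_rw [h1]
  rw [Finset.expect_sum_comm]
  simp_rw [← Finset.mul_expect, expect_phase_prod hm]
  simp only [mul_ite, mul_one, mul_zero]
  rw [← Finset.sum_filter]
  push_cast
  exact Finset.sum_bij (fun p h => Equiv.ofBijective p (Finset.mem_filter.1 h).2)
    (fun _ _ => Finset.mem_univ _)
    (fun _ _ _ _ h => by injection h)
    (fun b _ => ⟨b, Finset.mem_filter.2 ⟨Finset.mem_univ _, b.bijective⟩,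
      Equiv.coe_fn_injective rfl⟩)
    (fun _ _ => rfl)

/-- The total amount by which the moduli of the entries of `A x` fall short of one,
at the phase vector `x` given by `X`. -/
noncomputable def rowDefect {ι : Type*} [Fintype ι] {m : ℕ} [NeZero m] (A : ι → ι → ℝ)
    (X : ι → ZMod m) : ℝ := ∑ i, (1 - ‖phaseSum (A i) Finset.univ X‖)

lemma rowDefect_nonneg {ι : Type*} [Fintype ι] {m : ℕ} [NeZero m] {A : ι → ι → ℝ}
    (hA : ∀ x : ι → ℂ, ∑ i, ‖∑ j, (A i j : ℂ) * x j‖ ^ 2 ≤ ∑ j, ‖x j‖ ^ 2) (X : ι → ZMod m) :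
    0 ≤ rowDefect A X := by
  have h := hA fun j => ZMod.stdAddChar (X j)
  simp only [norm_stdAddChar] at h
  have h2 : ∑ i, (1 - ‖phaseSum (A i) Finset.univ X‖ ^ 2) / 2 ≤ rowDefect A X :=
    Finset.sum_le_sum fun i _ => by nlinarith [sq_nonneg (1 - ‖phaseSum (A i) Finset.univ X‖)]
  refine le_trans ?_ h2
  rw [← Finset.sum_div, Finset.sum_sub_distrib]
  simp only [phaseSum]
  simp at h ⊢
  linarith

lemma abs_permanent_le_expect_exp {ι : Type*} [Fintype ι] [DecidableEq ι] {m : ℕ} [NeZero m]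
    (hm : 1 < m) (A : ι → ι → ℝ) :
    |∑ σ : Equiv.Perm ι, ∏ i, A i (σ i)| ≤ 𝔼 X : ι → ZMod m, Real.exp (-rowDefect A X) := by
  rw [← Real.norm_eq_abs, ← Complex.norm_real, ← expect_phase_eq_permanent (m := m) hm A]
  refine le_trans (Finset.le_expect_of_subadditive (m := norm) norm_zero norm_add_le ?_) ?_
  · intro n a
    simp [NNRat.smul_def]
  · refine Finset.expect_le_expect fun X _ => ?_
    rw [norm_mul, norm_prod, norm_prod, rowDefect, ← Finset.sum_neg_distrib, Real.exp_sum]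
    simp only [RCLike.norm_conj, norm_stdAddChar, Finset.prod_const_one, one_mul]
    refine Finset.prod_le_prod (fun _ _ => norm_nonneg _) fun i _ => ?_
    have := Real.add_one_le_exp (-(1 - ‖phaseSum (A i) Finset.univ X‖))
    linarith

lemma re_mul_one_sub_stdAddChar_le {m : ℕ} [NeZero m] (b : ℂ) (d : ℤ) (hd : |d| ≤ 1) :
    (b * (1 - ZMod.stdAddChar (d : ZMod m))).re ≤
      Real.sin (2 * Real.pi / m) * (d * b.im) + (2 * Real.pi / m) ^ 2 / 2 * ‖b‖ := by
  set η := 2 * Real.pi / m with hη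
  have hχ : ZMod.stdAddChar (d : ZMod m) = Complex.exp ((η * d : ℝ) * Complex.I) := by
    rw [ZMod.stdAddChar_coe, hη]; push_cast; congr 1; ring
  have hcos := Real.one_sub_sq_div_two_le_cos (x := η)
  have hcos1 := Real.cos_le_one η
  have hb := Complex.abs_re_le_norm b
  have hb' : (1 - Real.cos η) * b.re ≤ η ^ 2 / 2 * ‖b‖ := by
    have : (1 - Real.cos η) * b.re ≤ (1 - Real.cos η) * ‖b‖ :=
      mul_le_mul_of_nonneg_left (le_trans (le_abs_self _) hb) (by linarith)
    nlinarith [norm_nonneg b]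
  have hpos : 0 ≤ η ^ 2 / 2 * ‖b‖ := by positivity
  rw [hχ, Complex.mul_re, Complex.sub_re, Complex.sub_im, Complex.exp_ofReal_mul_I_re,
    Complex.exp_ofReal_mul_I_im, Complex.one_re, Complex.one_im]
  rw [abs_le] at hd
  obtain rfl | rfl | rfl : d = -1 ∨ d = 0 ∨ d = 1 := by omega
  · simp; linarith
  · simpa using hpos
  · simp; linarith

/-- Every small rotation of the phases changes `rowDefect` by at most a linear term whose gradient
is controlled by `rowDefect` itself, up to a second-order error. -/
lemma exists_rowDefect_gradient {ι : Type*} [Fintype ι] {m : ℕ} [NeZero m] {A : ι → ι → ℝ}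
    (hAt : ∀ z : ι → ℂ, ∑ j, ‖∑ i, (A i j : ℂ) * z i‖ ^ 2 ≤ ∑ i, ‖z i‖ ^ 2) (X : ι → ZMod m) :
    ∃ g : ι → ℝ, ∑ j, g j ^ 2 ≤ 2 * rowDefect A X ∧ ∀ d : ι → ℤ, (∀ j, |d j| ≤ 1) →
      rowDefect A (X + fun j => (d j : ZMod m)) - rowDefect A X ≤
        Real.sin (2 * Real.pi / m) * ∑ j, d j * g j +
          (2 * Real.pi / m) ^ 2 / 2 * Fintype.card ι := by
  set y : ι → ℂ := fun i => phaseSum (A i) Finset.univ X with hy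
  set ν : ι → ℂ := fun i => conj (y i) / ‖y i‖ with hν
  have hν1 : ∀ i, ‖ν i‖ ≤ 1 := by
    intro i
    simp only [hν, norm_div, RCLike.norm_conj, Complex.norm_real, norm_norm]
    exact div_self_le_one _
  have hνy : ∀ i, ν i * y i = ‖y i‖ := by
    intro i
    simp only [hν]
    by_cases h : ‖y i‖ = 0
    · simp [norm_eq_zero.1 h]
    · rw [div_mul_eq_mul_div, ← Complex.normSq_eq_conj_mul_self, Complex.normSq_eq_norm_sq]
      have : (‖y i‖ : ℂ) ≠ 0 := by exact_mod_cast h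
      field_simp
      push_cast; ring
  set b : ι → ℂ := fun j => (∑ i, (A i j : ℂ) * ν i) * ZMod.stdAddChar (X j) with hb
  have hbn : ∑ j, ‖b j‖ ^ 2 ≤ Fintype.card ι := by
    have h1 : ∀ j, ‖b j‖ ^ 2 = ‖∑ i, (A i j : ℂ) * ν i‖ ^ 2 := by
      intro j; simp only [hb, norm_mul, norm_stdAddChar, mul_one]
    simp_rw [h1]
    refine (hAt ν).trans ?_
    refine (Finset.sum_le_sum fun i _ => pow_le_one₀ (norm_nonneg _) (hν1 i)).trans ?_
    simp
  have hbsum : ∑ j, b j = ((Fintype.card ι - rowDefect A X : ℝ) : ℂ) := by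
    have : ∑ j, b j = ∑ i, ν i * y i := by
      simp only [hb, hy, phaseSum, Finset.sum_mul, Finset.mul_sum]
      rw [Finset.sum_comm]
      refine Finset.sum_congr rfl fun i _ => Finset.sum_congr rfl fun j _ => by ring
    rw [this]
    simp_rw [hνy]
    rw [← Complex.ofReal_sum]
    congr 1
    simp [rowDefect, hy]
  have hre : ∑ j, (b j).re = Fintype.card ι - rowDefect A X := by
    rw [← Complex.re_sum, hbsum, Complex.ofReal_re]
  refine ⟨fun j => (b j).im, ?_, ?_⟩
  · have h1 : ∑ j, (b j).im ^ 2 ≤ ∑ j, (‖b j‖ ^ 2 - (2 * (b j).re - 1)) := by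
      refine Finset.sum_le_sum fun j _ => ?_
      rw [← Complex.normSq_eq_norm_sq, Complex.normSq_apply]
      nlinarith [sq_nonneg ((b j).re - 1)]
    refine h1.trans ?_
    rw [Finset.sum_sub_distrib, Finset.sum_sub_distrib, ← Finset.mul_sum, hre]
    simp
    linarith
  · intro d hd
    have h1 : rowDefect A (X + fun j => (d j : ZMod m)) - rowDefect A X ≤
        ∑ j, (b j * (1 - ZMod.stdAddChar (d j : ZMod m))).re := by
      have e1 : ∑ j, (b j * (1 - ZMod.stdAddChar (d j : ZMod m))) =
          ∑ i, (ν i * y i - ν i * phaseSum (A i) Finset.univ (X + fun j => (d j : ZMod m))) := by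
        simp only [hb, hy, phaseSum, Finset.sum_mul, Finset.mul_sum, ← Finset.sum_sub_distrib]
        rw [Finset.sum_comm]
        refine Finset.sum_congr rfl fun i _ => Finset.sum_congr rfl fun j _ => ?_
        rw [Pi.add_apply, AddChar.map_add_eq_mul]; ring
      rw [← Complex.re_sum, e1, Complex.re_sum, rowDefect, rowDefect, ← Finset.sum_sub_distrib]
      refine Finset.sum_le_sum fun i _ => ?_
      rw [hνy, Complex.sub_re, Complex.ofReal_re]
      have h2 : (ν i * phaseSum (A i) Finset.univ (X + fun j => (d j : ZMod m))).re ≤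
          ‖phaseSum (A i) Finset.univ (X + fun j => (d j : ZMod m))‖ := by
        refine (Complex.re_le_norm _).trans ?_
        rw [norm_mul]
        exact mul_le_of_le_one_left (norm_nonneg _) (hν1 i)
      simp only [hy]
      linarith
    refine h1.trans ((Finset.sum_le_sum fun j _ =>
      re_mul_one_sub_stdAddChar_le (b j) (d j) (hd j)).trans ?_)
    rw [Finset.sum_add_distrib, ← Finset.mul_sum, ← Finset.mul_sum]
    gcongr
    have h3 : ∑ j, ‖b j‖ ≤ ∑ j, (1 + ‖b j‖ ^ 2) / 2 :=
      Finset.sum_le_sum fun j _ => by nlinarith [sq_nonneg (1 - ‖b j‖)]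
    refine h3.trans ?_
    rw [← Finset.sum_div, Finset.sum_add_distrib]
    simp
    linarith

lemma expect_pi_prod {ι κ : Type*} [Fintype ι] [DecidableEq ι] [Fintype κ] (f : ι → κ → ℝ) :
    𝔼 V : ι → κ, ∏ j, f j (V j) = ∏ j, 𝔼 v : κ, f j v := by
  simp_rw [Fintype.expect_eq_sum_div_card]
  rw [Finset.prod_div_distrib, Finset.prod_univ_sum, Fintype.piFinset_univ]
  simp

/-- The `s`-th unit step of the shortest path from `0` to `v` in the cycle `ZMod m`. -/
def cycleStep {m : ℕ} (s : ℕ) (v : ZMod m) : ℤ :=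
  if s < v.valMinAbs.natAbs then v.valMinAbs.sign else 0

lemma abs_cycleStep_le {m : ℕ} (s : ℕ) (v : ZMod m) : |cycleStep s v| ≤ 1 := by
  unfold cycleStep
  split_ifs
  · rcases lt_trichotomy v.valMinAbs 0 with h | h | h <;> simp [h, Int.sign_eq_neg_one_of_neg,
      Int.sign_eq_one_of_pos]
  · simp

lemma cycleStep_neg {N : ℕ} (s : ℕ) (v : ZMod (2 * N + 1)) :
    cycleStep s (-v) = -cycleStep s v := by
  unfold cycleStep
  rw [ZMod.valMinAbs_neg_of_ne_half (by omega), Int.natAbs_neg, Int.sign_neg]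
  split_ifs <;> simp

lemma sum_cycleStep {N : ℕ} (v : ZMod (2 * N + 1)) :
    ((∑ s ∈ Finset.range N, cycleStep s v : ℤ) : ZMod (2 * N + 1)) = v := by
  have hle : v.valMinAbs.natAbs ≤ N := by
    have := ZMod.natAbs_valMinAbs_le v
    omega
  have : ∑ s ∈ Finset.range N, cycleStep s v = v.valMinAbs := by
    unfold cycleStep
    rw [← Finset.sum_filter, Finset.sum_const]
    have : Finset.filter (fun s => s < v.valMinAbs.natAbs) (Finset.range N) =
        Finset.range v.valMinAbs.natAbs := by
      ext s; simp; omega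
    rw [this, Finset.card_range, nsmul_eq_mul, mul_comm]
    exact Int.sign_mul_natAbs _
  rw [this, ZMod.coe_valMinAbs]

lemma expect_exp_cycleStep_le {N : ℕ} (s : ℕ) (ρ : ℝ) :
    𝔼 v : ZMod (2 * N + 1), Real.exp (ρ * cycleStep s v) ≤ Real.exp (ρ ^ 2 / 2) := by
  have h1 : 𝔼 v : ZMod (2 * N + 1), Real.exp (ρ * cycleStep s v) =
      𝔼 v : ZMod (2 * N + 1), Real.exp (-(ρ * cycleStep s v)) :=
    Fintype.expect_equiv (Equiv.neg _) _ _ fun v => by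
      simp [cycleStep_neg]
  have h2 : 𝔼 v : ZMod (2 * N + 1), Real.exp (ρ * cycleStep s v) =
      𝔼 v : ZMod (2 * N + 1), Real.cosh (ρ * cycleStep s v) := by
    simp_rw [Real.cosh_eq]
    rw [← Finset.expect_div, Finset.expect_add_distrib, ← h1]; ring
  rw [h2]
  refine Finset.expect_le Finset.univ_nonempty fun v _ => (Real.cosh_le_exp_half_sq _).trans ?_
  rw [Real.exp_le_exp]
  have : ((cycleStep s v : ℤ) : ℝ) ^ 2 ≤ 1 := by
    have h : |((cycleStep s v : ℤ) : ℝ)| ≤ 1 := by exact_mod_cast abs_cycleStep_le s v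
    rw [← sq_abs]; exact pow_le_one₀ (abs_nonneg _) h
  rw [mul_pow]
  nlinarith [sq_nonneg ρ]

lemma exp_sum_range_le {N : ℕ} (hN : 0 < N) (u : ℕ → ℝ) :
    Real.exp (∑ s ∈ Finset.range N, u s) ≤ 𝔼 s ∈ Finset.range N, Real.exp (N * u s) := by
  have hN' : (N : ℝ) ≠ 0 := by positivity
  have := convexOn_exp.map_sum_le (t := Finset.range N) (w := fun _ => (N : ℝ)⁻¹)
    (p := fun s => N * u s) (fun _ _ => by positivity) (by simp [hN']) (fun _ _ => Set.mem_univ _)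
  simp only [smul_eq_mul, inv_mul_cancel_left₀ hN'] at this
  rw [Finset.expect_eq_sum_div_card, Finset.card_range, Finset.sum_div]
  refine this.trans (le_of_eq (Finset.sum_congr rfl fun s _ => by rw [inv_mul_eq_div]))

/-- Exponential moments of one step of the path coupling two independent phase vectors. -/
lemma expect_exp_rowDefect_step_le {ι : Type*} [Fintype ι] [DecidableEq ι] {N : ℕ} (hN : 0 < N)
    {A : ι → ι → ℝ}
    (hAt : ∀ z : ι → ℂ, ∑ j, ‖∑ i, (A i j : ℂ) * z i‖ ^ 2 ≤ ∑ i, ‖z i‖ ^ 2)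
    {l : ℝ} (hl : 0 ≤ l) (s : ℕ) (X : ι → ZMod (2 * N + 1)) :
    𝔼 V : ι → ZMod (2 * N + 1), Real.exp (N * (l *
        (rowDefect A (X + fun j => ((cycleStep s (V j) : ℤ) : ZMod (2 * N + 1))) -
          rowDefect A X))) ≤
      Real.exp (l * Real.pi ^ 2 * Fintype.card ι / (2 * N)) *
        Real.exp (l ^ 2 * Real.pi ^ 2 * rowDefect A X) := by
  obtain ⟨g, hg, hstep⟩ := exists_rowDefect_gradient hAt X
  set η : ℝ := 2 * Real.pi / ((2 * N + 1 : ℕ) : ℝ) with hη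
  have hNr : (0 : ℝ) < N := by exact_mod_cast hN
  have hη0 : 0 ≤ η := by positivity
  have hNη : N * η ≤ Real.pi := by
    rw [hη, mul_div_assoc', div_le_iff₀ (by positivity)]
    push_cast
    nlinarith [Real.pi_pos]
  have hηpi : η ≤ Real.pi := by
    have : (1 : ℝ) ≤ N := by exact_mod_cast hN
    nlinarith
  have hsin0 : 0 ≤ Real.sin η := Real.sin_nonneg_of_nonneg_of_le_pi hη0 hηpi
  have hsin : Real.sin η ≤ η := Real.sin_le hη0
  have hbound : ∀ V : ι → ZMod (2 * N + 1), Real.exp (N * (l *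
        (rowDefect A (X + fun j => ((cycleStep s (V j) : ℤ) : ZMod (2 * N + 1))) -
          rowDefect A X))) ≤
      Real.exp (l * Real.pi ^ 2 * Fintype.card ι / (2 * N)) *
        ∏ j, Real.exp ((N * l * Real.sin η * g j) * cycleStep s (V j)) := by
    intro V
    rw [← Real.exp_sum, ← Real.exp_add, Real.exp_le_exp]
    have h1 := hstep (fun j => cycleStep s (V j)) fun j => abs_cycleStep_le _ _
    have h2 := mul_le_mul_of_nonneg_left h1 (by positivity : 0 ≤ N * l)
    have h3 : ∑ j, (N * l * Real.sin η * g j) * cycleStep s (V j) =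
        N * l * (Real.sin η * ∑ j, cycleStep s (V j) * g j) := by
      rw [Finset.mul_sum, Finset.mul_sum]
      exact Finset.sum_congr rfl fun j _ => by ring
    have h4 : N * l * (η ^ 2 / 2 * Fintype.card ι) ≤
        l * Real.pi ^ 2 * Fintype.card ι / (2 * N) := by
      rw [le_div_iff₀ (by positivity)]
      have : (N * η) ^ 2 ≤ Real.pi ^ 2 := pow_le_pow_left₀ (by positivity) hNη 2
      have := mul_le_mul_of_nonneg_left this (by positivity : 0 ≤ l * Fintype.card ι)
      linarith
    rw [h3]
    linarith
  refine (Finset.expect_le_expect fun V _ => hbound V).trans ?_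
  rw [← Finset.mul_expect,
    expect_pi_prod fun j v => Real.exp ((N * l * Real.sin η * g j) * cycleStep s v)]
  gcongr
  refine (Finset.prod_le_prod (fun j _ => Finset.expect_nonneg fun _ _ => (Real.exp_pos _).le)
    fun j _ => expect_exp_cycleStep_le s _).trans ?_
  rw [← Real.exp_sum, Real.exp_le_exp]
  have h5 : ∀ j, (N * l * Real.sin η * g j) ^ 2 / 2 ≤ l ^ 2 * Real.pi ^ 2 / 2 * g j ^ 2 := by
    intro j
    have h6 : (N * Real.sin η) ^ 2 ≤ Real.pi ^ 2 :=
      pow_le_pow_left₀ (by positivity) ((mul_le_mul_of_nonneg_left hsin hNr.le).trans hNη) 2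
    have := mul_le_mul_of_nonneg_left h6 (by positivity : 0 ≤ l ^ 2 * g j ^ 2)
    linarith
  refine (Finset.sum_le_sum fun j _ => h5 j).trans ?_
  rw [← Finset.mul_sum]
  nlinarith [mul_le_mul_of_nonneg_left hg (by positivity : 0 ≤ l ^ 2 * Real.pi ^ 2 / 2)]

/-- Coupling along shortest paths: exponential moments of the difference of `rowDefect` at two
independent phase vectors are controlled by exponential moments of `rowDefect`. -/
lemma expect_exp_mul_expect_exp_neg_le {ι : Type*} [Fintype ι] [DecidableEq ι] {N : ℕ}
    (hN : 0 < N) {A : ι → ι → ℝ}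
    (hAt : ∀ z : ι → ℂ, ∑ j, ‖∑ i, (A i j : ℂ) * z i‖ ^ 2 ≤ ∑ i, ‖z i‖ ^ 2)
    {l : ℝ} (hl : 0 ≤ l) :
    (𝔼 X : ι → ZMod (2 * N + 1), Real.exp (l * rowDefect A X)) *
      (𝔼 X : ι → ZMod (2 * N + 1), Real.exp (-(l * rowDefect A X))) ≤
      Real.exp (l * Real.pi ^ 2 * Fintype.card ι / (2 * N)) *
        𝔼 X : ι → ZMod (2 * N + 1), Real.exp (l ^ 2 * Real.pi ^ 2 * rowDefect A X) := by
  set G := ι → ZMod (2 * N + 1)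
  set step : ℕ → G → G := fun s V j => ((cycleStep s (V j) : ℤ) : ZMod (2 * N + 1)) with hstep
  set path : ℕ → G → G := fun s V => ∑ t ∈ Finset.range s, step t V with hpath
  have hend : ∀ V : G, path N V = V := by
    intro V
    funext j
    have := sum_cycleStep (V j)
    push_cast at this
    show (∑ t ∈ Finset.range N, step t V) j = V j
    rw [Finset.sum_apply]
    exact this
  have h1 : (𝔼 X : G, Real.exp (l * rowDefect A X)) * (𝔼 X : G, Real.exp (-(l * rowDefect A X)))
      = 𝔼 X : G, 𝔼 V : G, Real.exp (l * (rowDefect A (X + V) - rowDefect A X)) := by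
    rw [mul_comm, Finset.expect_mul]
    refine Finset.expect_congr rfl fun X _ => ?_
    rw [Finset.mul_expect]
    refine Fintype.expect_equiv (Equiv.subRight X) _ _ fun Y => ?_
    simp only [Equiv.subRight_apply, add_sub_cancel]
    rw [← Real.exp_add]
    congr 1; ring
  have h2 : ∀ X V : G, Real.exp (l * (rowDefect A (X + V) - rowDefect A X)) ≤
      𝔼 s ∈ Finset.range N, Real.exp (N * (l *
        (rowDefect A (X + path s V + step s V) - rowDefect A (X + path s V)))) := by
    intro X V
    refine le_trans (le_of_eq ?_) (exp_sum_range_le hN fun s => l *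
        (rowDefect A (X + path s V + step s V) - rowDefect A (X + path s V)))
    congr 1
    rw [← Finset.mul_sum]
    congr 1
    have := Finset.sum_range_sub (fun s => rowDefect A (X + path s V)) N
    rw [hend] at this
    simp only [hpath, Finset.sum_range_succ, Finset.range_zero, Finset.sum_empty, add_zero,
      ← add_assoc] at this
    exact this.symm
  rw [h1]
  refine (Finset.expect_le_expect fun X _ => Finset.expect_le_expect fun V _ => h2 X V).trans ?_
  simp_rw [Finset.expect_comm (Finset.univ : Finset G) (Finset.range N)]
  refine Finset.expect_le (by simpa using hN.ne') fun s _ => ?_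
  rw [Finset.expect_comm]
  have h3 : ∀ V : G, 𝔼 X : G, Real.exp (N * (l *
        (rowDefect A (X + path s V + step s V) - rowDefect A (X + path s V)))) =
      𝔼 X : G, Real.exp (N * (l * (rowDefect A (X + step s V) - rowDefect A X))) := fun V =>
    expect_add_right (fun X => Real.exp (N * (l * (rowDefect A (X + step s V) - rowDefect A X)))) _
  simp_rw [h3]
  rw [Finset.expect_comm, Finset.mul_expect]
  exact Finset.expect_le_expect fun X _ => expect_exp_rowDefect_step_le hN hAt hl s X

/-- Jensen's inequality for the exponential and a uniform average. -/
lemma exp_expect_le {G : Type*} [Fintype G] [Nonempty G] (f : G → ℝ) :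
    Real.exp (𝔼 x, f x) ≤ 𝔼 x, Real.exp (f x) := by
  set c := 𝔼 x, f x with hc
  have h : 𝔼 x, Real.exp c * (1 + (f x - c)) = Real.exp c := by
    rw [← Finset.mul_expect, Finset.expect_add_distrib, Finset.expect_sub_distrib,
      Fintype.expect_const, Fintype.expect_const, ← hc]
    ring
  rw [← h]
  refine Finset.expect_le_expect fun x _ => ?_
  have h1 := Real.add_one_le_exp (f x - c)
  have h2 := mul_le_mul_of_nonneg_left h1 (Real.exp_pos c).le
  rw [← Real.exp_add, add_sub_cancel] at h2
  linarith

/-- For contractions, the permanent is exponentially small in the total deficiency of the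
row maxima. -/
lemma abs_permanent_le_exp {ι : Type*} [Fintype ι] [DecidableEq ι] {A : ι → ι → ℝ}
    (hA : ∀ x : ι → ℂ, ∑ i, ‖∑ j, (A i j : ℂ) * x j‖ ^ 2 ≤ ∑ j, ‖x j‖ ^ 2)
    (hAt : ∀ z : ι → ℂ, ∑ j, ‖∑ i, (A i j : ℂ) * z i‖ ^ 2 ≤ ∑ i, ‖z i‖ ^ 2)
    {M : ι → ℝ} (hM : ∀ i j, |A i j| ≤ M i) (hM0 : ∀ i, 0 ≤ M i) :
    |∑ σ : Equiv.Perm ι, ∏ i, A i (σ i)| ≤ Real.exp (1 / 4 - (∑ i, (1 - M i)) / 2560) := by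
  set N := Fintype.card ι + 2 with hN
  have hrow : ∀ i, ∑ j, A i j ^ 2 ≤ 1 := by
    intro i
    have h := hAt (Pi.single i 1)
    simpa [Pi.single_apply, apply_ite] using h
  set Z : (ι → ZMod (2 * N + 1)) → ℝ := rowDefect A with hZ
  have hZ0 : ∀ X, 0 ≤ Z X := fun X => rowDefect_nonneg hA X
  have hEZ : (∑ i, (1 - M i)) / 64 ≤ 𝔼 X, Z X := by
    simp only [hZ, rowDefect]
    rw [Finset.expect_sum_comm, Finset.sum_div]
    exact Finset.sum_le_sum fun i _ =>
      one_sub_le_expect_one_sub_norm (by omega) (A i) (hrow i) (M i) (hM i) (hM0 i)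
  have hperm : |∑ σ : Equiv.Perm ι, ∏ i, A i (σ i)| ≤ 𝔼 X, Real.exp (-(1 / 20 * Z X)) := by
    refine (abs_permanent_le_expect_exp (m := 2 * N + 1) (by omega) A).trans ?_
    refine Finset.expect_le_expect fun X _ => Real.exp_le_exp.2 ?_
    have := hZ0 X
    simp only [hZ] at this ⊢
    linarith
  have hpi : Real.pi ^ 2 ≤ 10 := by
    nlinarith [Real.pi_lt_d2, Real.pi_pos]
  set h := 𝔼 X, Real.exp (1 / 40 * Z X) with hh
  have hprod : (𝔼 X, Real.exp (1 / 20 * Z X)) * (𝔼 X, Real.exp (-(1 / 20 * Z X))) ≤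
      Real.exp (1 / 4) * h := by
    refine (expect_exp_mul_expect_exp_neg_le (by omega) hAt (by norm_num)).trans ?_
    refine mul_le_mul (Real.exp_le_exp.2 ?_)
      (Finset.expect_le_expect fun X _ => Real.exp_le_exp.2 ?_)
      (Finset.expect_nonneg fun X _ => (Real.exp_pos _).le) (Real.exp_pos _).le
    · rw [div_le_iff₀ (by positivity)]
      have : (Fintype.card ι : ℝ) ≤ N := by rw [hN]; push_cast; linarith
      have h0 : (0 : ℝ) ≤ Fintype.card ι := Nat.cast_nonneg _
      nlinarith
    · exact mul_le_mul_of_nonneg_right (by linarith) (hZ0 X)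
  have hjensen : Real.exp ((∑ i, (1 - M i)) / 2560) ≤ h := by
    refine le_trans (Real.exp_le_exp.2 ?_) (exp_expect_le fun X => 1 / 40 * Z X)
    rw [← Finset.mul_expect]
    linarith
  have hsq : h ^ 2 ≤ 𝔼 X, Real.exp (1 / 20 * Z X) := by
    have h1 := Finset.expect_mul_sq_le_sq_mul_sq Finset.univ
      (fun X => Real.exp (1 / 40 * Z X)) (fun _ => 1)
    simp only [mul_one, one_pow, Fintype.expect_const, ← Real.exp_nat_mul] at h1
    refine h1.trans (le_of_eq (Finset.expect_congr rfl fun X _ => ?_))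
    congr 1
    push_cast; ring
  have hpos : 0 < h := (Real.exp_pos _).trans_le hjensen
  set b := 𝔼 X, Real.exp (-(1 / 20 * Z X)) with hb
  have hb0 : 0 ≤ b := Finset.expect_nonneg fun X _ => (Real.exp_pos _).le
  have hhb : h * b ≤ Real.exp (1 / 4) := by
    have h1 := (mul_le_mul_of_nonneg_right hsq hb0).trans hprod
    refine le_of_mul_le_mul_left ?_ hpos
    linarith
  refine hperm.trans ?_
  rw [Real.exp_sub, le_div_iff₀ (Real.exp_pos _), mul_comm]
  exact (mul_le_mul_of_nonneg_right hjensen hb0).trans hhb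

/-- A real matrix which is a contraction in the Euclidean norm is one over `ℂ` as well. -/
lemma sum_norm_sq_mulVec_le {ι : Type*} [Fintype ι] {A : ι → ι → ℝ}
    (hA : ∀ x : ι → ℝ, ∑ i, (∑ j, A i j * x j) ^ 2 ≤ ∑ j, x j ^ 2) (x : ι → ℂ) :
    ∑ i, ‖∑ j, (A i j : ℂ) * x j‖ ^ 2 ≤ ∑ j, ‖x j‖ ^ 2 := by
  have h := add_le_add (hA fun j => (x j).re) (hA fun j => (x j).im)
  rw [← Finset.sum_add_distrib, ← Finset.sum_add_distrib] at h
  refine (le_of_eq ?_).trans (h.trans (le_of_eq ?_)) <;>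
  · refine Finset.sum_congr rfl fun i _ => ?_
    rw [← Complex.normSq_eq_norm_sq, Complex.normSq_apply]
    simp [pow_two]

/-- The transpose of a contraction is a contraction. -/
lemma sum_sq_vecMul_le {ι : Type*} [Fintype ι] {A : ι → ι → ℝ}
    (hA : ∀ x : ι → ℝ, ∑ i, (∑ j, A i j * x j) ^ 2 ≤ ∑ j, x j ^ 2) (z : ι → ℝ) :
    ∑ j, (∑ i, A i j * z i) ^ 2 ≤ ∑ i, z i ^ 2 := by
  set w : ι → ℝ := fun j => ∑ i, A i j * z i with hw
  have h1 : ∑ j, w j ^ 2 = ∑ i, z i * ∑ j, A i j * w j := by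
    simp only [Finset.mul_sum]
    rw [Finset.sum_comm]
    refine Finset.sum_congr rfl fun j _ => ?_
    rw [pow_two]
    nth_rewrite 1 [hw]
    simp only [Finset.sum_mul]
    exact Finset.sum_congr rfl fun i _ => by ring
  have h2 : ∑ i, z i * ∑ j, A i j * w j ≤
      ∑ i, (z i ^ 2 + (∑ j, A i j * w j) ^ 2) / 2 :=
    Finset.sum_le_sum fun i _ => by nlinarith [sq_nonneg (z i - ∑ j, A i j * w j)]
  rw [← Finset.sum_div, Finset.sum_add_distrib, ← h1] at h2
  linarith [hA w]

lemma sum_sq_mulVec_le_opNormR {n : ℕ} (A : Matrix (Fin n) (Fin n) ℝ) (x : Fin n → ℝ) :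
    ∑ i, (∑ j, A i j * x j) ^ 2 ≤ opNormR A ^ 2 * ∑ j, x j ^ 2 := by
  have h := (LinearMap.toContinuousLinearMap (Matrix.toEuclideanLin A)).le_opNorm
    (WithLp.toLp 2 x)
  have h2 := pow_le_pow_left₀ (norm_nonneg _) h 2
  rw [mul_pow, EuclideanSpace.norm_sq_eq, EuclideanSpace.norm_sq_eq] at h2
  simpa [Matrix.mulVec, dotProduct, opNormR] using h2

lemma exp_quarter_sub_le (n : ℕ) {k : ℝ} (hk : 0 ≤ k) :
    Real.exp (1 / 4 - k / 2560) ≤ (n + 6) * Real.exp (-Real.sqrt k / 400) := by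
  have h1 : 1 / 4 - k / 2560 ≤ 1 + -Real.sqrt k / 400 := by
    nlinarith [Real.sq_sqrt hk, sq_nonneg (Real.sqrt k - 3)]
  refine (Real.exp_le_exp.2 h1).trans ?_
  rw [Real.exp_add]
  refine mul_le_mul_of_nonneg_right ?_ (Real.exp_pos _).le
  have := Real.exp_one_lt_d9
  have : (0 : ℝ) ≤ n := Nat.cast_nonneg n
  linarith

/-- Main stability theorem over ℝ:
`|perm A| ≤ Tⁿ (n+6) exp(−√(n(1 − h∞/T))/400)` whenever `‖A‖₂ ≤ T ≠ 0`. -/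
theorem main_stability_real {n : ℕ} (A : Matrix (Fin n) (Fin n) ℝ) (T : ℝ)
    (hT : T ≠ 0) (hA : opNormR A ≤ T) :
    |permR A| ≤ T ^ n * (n + 6) *
      Real.exp (-Real.sqrt (n * (1 - hInfR A / T)) / 400) := by
  have hT0 : 0 < T := lt_of_le_of_ne ((norm_nonneg _).trans hA) hT.symm
  have hB : ∀ x : Fin n → ℝ, ∑ i, (∑ j, A i j / T * x j) ^ 2 ≤ ∑ j, x j ^ 2 := by
    intro x
    have h1 := sum_sq_mulVec_le_opNormR A x
    have h2 : opNormR A ^ 2 ≤ T ^ 2 := pow_le_pow_left₀ (norm_nonneg _) hA 2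
    have h3 := h1.trans (mul_le_mul_of_nonneg_right h2
      (Finset.sum_nonneg fun j _ => sq_nonneg (x j)))
    have h4 : ∑ i, (∑ j, A i j / T * x j) ^ 2 = (∑ i, (∑ j, A i j * x j) ^ 2) / T ^ 2 := by
      simp_rw [div_mul_eq_mul_div, ← Finset.sum_div, div_pow, ← Finset.sum_div]
    rw [h4, div_le_iff₀ (by positivity), mul_comm]
    exact h3
  have hk : n * (1 - hInfR A / T) = ∑ i, (1 - (⨆ j, |A i j|) / T) := by
    rw [Finset.sum_sub_distrib, ← Finset.sum_div, hInfR]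
    rcases Nat.eq_zero_or_pos n with rfl | hn
    · simp
    · have : (n : ℝ) ≠ 0 := by positivity
      simp
      field_simp
  have hperm : permR A = T ^ n * ∑ σ : Equiv.Perm (Fin n), ∏ i, A i (σ i) / T := by
    rw [permR, Finset.mul_sum]
    refine Finset.sum_congr rfl fun σ _ => ?_
    rw [Finset.prod_div_distrib]
    simp
    field_simp
  have hmain := abs_permanent_le_exp (A := fun i j => A i j / T)
    (M := fun i => (⨆ j, |A i j|) / T) (sum_norm_sq_mulVec_le hB)
    (sum_norm_sq_mulVec_le (A := fun j i => A i j / T) (sum_sq_vecMul_le hB))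
    (fun i j => by
      rw [abs_div, abs_of_pos hT0]
      exact div_le_div_of_nonneg_right (le_ciSup (Set.finite_range fun j => |A i j|).bddAbove j)
        hT0.le)
    (fun i => div_nonneg (Real.iSup_nonneg fun j => abs_nonneg _) hT0.le)
  have hk0 : 0 ≤ ∑ i, (1 - (⨆ j, |A i j|) / T) := by
    refine Finset.sum_nonneg fun i _ => sub_nonneg.2 ((div_le_one hT0).2 ?_)
    refine Real.iSup_le (fun j => ?_) hT0.le
    have h := hB (Pi.single j 1)
    have h1 := (Finset.single_le_sum (fun i _ => sq_nonneg _) (Finset.mem_univ i)).trans h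
    simp [Pi.single_apply] at h1
    rwa [abs_div, abs_of_pos hT0, div_le_one hT0] at h1
  rw [hk, hperm, abs_mul, abs_of_pos (pow_pos hT0 n), mul_assoc]
  exact mul_le_mul_of_nonneg_left (hmain.trans (exp_quarter_sub_le n hk0)) (pow_pos hT0 n).le
end
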